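/- arXiv:2512.02428 — 5 statements merged into one kernel-verified Lean document; each statement's English description precedes it below -/
import Mathlib

section
/- Let q be a positive integer and χ a Dirichlet character modulo q. Let σ > 1/2, 355991 ≤ λ < ρ, and let θ_p be real numbers indexed by primes p. Then for s with Re s = σ, | −∑_{λ < p ≤ ρ} log(1 − χ(p) e^{−2πi θ_p} p^{−s}) − ∑_{λ < p ≤ ρ} χ(p) e^{−2πi θ_p} p^{−s} | ≤ (1.11 σ/(2σ − 1)) · 1/(λ^{2σ−1} log λ). -/
/-- The finset of primes `p ≤ x`. -/
noncomputable def primesUpTo (x : ℝ) : Finset ℕ :=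
  (Finset.range (⌊x⌋₊ + 1)).filter Nat.Prime

open ArithmeticFunction in
lemma aux_log_factorial (M N : ℕ) (h : N ≤ M) :
    ∑ d ∈ Finset.Ioc 0 M, vonMangoldt d * ((N / d : ℕ) : ℝ) = Real.log (N.factorial) := by
  induction N with
  | zero => simp
  | succ N ih =>
    rw [Nat.factorial_succ, Nat.cast_mul, Real.log_mul (by positivity) (by positivity),
      ← ih (by omega), ← vonMangoldt_sum]
    have : (N+1).divisors = (Finset.Ioc 0 M).filter (fun d => d ∣ N+1) := by
      ext d
      simp only [Nat.mem_divisors, Finset.mem_filter, Finset.mem_Ioc]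
      constructor
      · rintro ⟨h1, -⟩
        exact ⟨⟨Nat.pos_of_dvd_of_pos h1 (by omega), (Nat.le_of_dvd (by omega) h1).trans h⟩, h1⟩
      · rintro ⟨-, h1⟩; exact ⟨h1, by omega⟩
    rw [this, Finset.sum_filter, ← Finset.sum_add_distrib]
    refine Finset.sum_congr rfl fun d _ => ?_
    rw [Nat.succ_div]
    split_ifs <;> push_cast <;> ring

open ArithmeticFunction in
lemma aux_theta_sub (x : ℝ) :
    Chebyshev.theta x - Chebyshev.theta (x / 6) ≤
      Real.log (⌊x⌋₊.factorial) - Real.log (⌊x/2⌋₊.factorial) - Real.log (⌊x/3⌋₊.factorial)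
      - Real.log (⌊x/5⌋₊.factorial) + Real.log (⌊x/30⌋₊.factorial) := by
  unfold Chebyshev.theta
  have e6 : ⌊x/6⌋₊ = ⌊x⌋₊/6 := by simpa using Nat.floor_div_ofNat x 6
  rw [e6]
  have e2 : ⌊x/2⌋₊ = ⌊x⌋₊/2 := by simpa using Nat.floor_div_ofNat x 2
  have e3 : ⌊x/3⌋₊ = ⌊x⌋₊/3 := by simpa using Nat.floor_div_ofNat x 3
  have e5 : ⌊x/5⌋₊ = ⌊x⌋₊/5 := by simpa using Nat.floor_div_ofNat x 5
  have e30 : ⌊x/30⌋₊ = ⌊x⌋₊/30 := by simpa using Nat.floor_div_ofNat x 30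
  rw [e2, e3, e5, e30]
  generalize ⌊x⌋₊ = n
  rw [← aux_log_factorial n n le_rfl, ← aux_log_factorial n (n/2) (by omega),
    ← aux_log_factorial n (n/3) (by omega), ← aux_log_factorial n (n/5) (by omega),
    ← aux_log_factorial n (n/30) (by omega)]
  have : (Finset.Ioc 0 (n/6)).filter Nat.Prime =
      (Finset.Ioc 0 n).filter (fun p => p ≤ n/6 ∧ p.Prime) := by
    ext d
    simp only [Finset.mem_filter, Finset.mem_Ioc]
    constructor
    · rintro ⟨⟨h1, h2⟩, h3⟩; exact ⟨⟨h1, by omega⟩, h2, h3⟩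
    · rintro ⟨⟨h1, h2⟩, h3, h4⟩; exact ⟨⟨h1, h3⟩, h4⟩
  rw [this, Finset.sum_filter, Finset.sum_filter, ← Finset.sum_sub_distrib,
    ← Finset.sum_sub_distrib, ← Finset.sum_sub_distrib, ← Finset.sum_sub_distrib,
    ← Finset.sum_add_distrib]
  refine Finset.sum_le_sum fun d hd => ?_
  rw [Finset.mem_Ioc] at hd
  have hL : 0 ≤ vonMangoldt d := vonMangoldt_nonneg
  have r : vonMangoldt d * ((n / d : ℕ):ℝ) - vonMangoldt d * ((n / 2 / d : ℕ):ℝ)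
      - vonMangoldt d * ((n / 3 / d : ℕ):ℝ) - vonMangoldt d * ((n / 5 / d : ℕ):ℝ)
      + vonMangoldt d * ((n / 30 / d : ℕ):ℝ) =
      vonMangoldt d * (((n / d : ℕ):ℝ) - ((n / 2 / d : ℕ):ℝ)
      - ((n / 3 / d : ℕ):ℝ) - ((n / 5 / d : ℕ):ℝ) + ((n / 30 / d : ℕ):ℝ)) := by ring
  rw [r, Nat.div_right_comm n 2, Nat.div_right_comm n 3, Nat.div_right_comm n 5,
    Nat.div_right_comm n 30]
  have c6 : ¬ d ≤ n/6 → n / d < 6 := by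
    intro h
    rw [Nat.div_lt_iff_lt_mul hd.1]
    omega
  have c1 : 1 ≤ n / d := (Nat.one_le_div_iff hd.1).2 hd.2
  generalize n / d = m at *
  have h0 : (0:ℝ) ≤ (m:ℝ) - ((m/2:ℕ):ℝ) - ((m/3:ℕ):ℝ) - ((m/5:ℕ):ℝ) + ((m/30:ℕ):ℝ) := by
    have : m/2 + m/3 + m/5 ≤ m + m/30 := by omega
    have : ((m/2:ℕ):ℝ) + ((m/3:ℕ):ℝ) + ((m/5:ℕ):ℝ) ≤ m + ((m/30:ℕ):ℝ) := by exact_mod_cast this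
    linarith
  by_cases hp : d.Prime
  · by_cases h6 : d ≤ n / 6
    · simp only [hp, h6, and_self, if_true, sub_self]; positivity
    · simp only [hp, h6, if_true, false_and, if_false, sub_zero]
      have : m/2 + m/3 + m/5 + 1 ≤ m + m/30 := by have := c6 h6; omega
      have : ((m/2:ℕ):ℝ) + ((m/3:ℕ):ℝ) + ((m/5:ℕ):ℝ) + 1 ≤ m + ((m/30:ℕ):ℝ) := by
        exact_mod_cast this
      rw [vonMangoldt_apply_prime hp] at hL ⊢
      nlinarith
  · simp only [hp, and_false, if_false, sub_zero]; positivity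

lemma aux_mono (x y : ℝ) (hx : 1 ≤ x) (hxy : x ≤ y) :
    x * Real.log x - x ≤ y * Real.log y - y := by
  have hy : 0 < y := by linarith
  have h1 : Real.log (x/y) ≤ x/y - 1 := Real.log_le_sub_one_of_pos (div_pos (by linarith) hy)
  rw [Real.log_div (by linarith) (by linarith)] at h1
  have h2 : y * (Real.log x - Real.log y) ≤ x - y := by
    calc _ ≤ y * (x/y-1) := by gcongr
      _ = x - y := by field_simp
  nlinarith [Real.log_nonneg hx]

lemma aux_up_nat (n : ℕ) :
    Real.log ((n+1).factorial) ≤ (n+1:ℝ) * Real.log (n+1) - (n+1) + Real.log (n+1) + 1 := by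
  induction n with
  | zero => simp
  | succ n ih =>
    rw [Nat.factorial_succ, Nat.cast_mul, Real.log_mul (by positivity) (by positivity)]
    push_cast
    have h1 : Real.log ((n+1:ℝ)/(n+1+1)) ≤ (n+1:ℝ)/(n+1+1) - 1 :=
      Real.log_le_sub_one_of_pos (by positivity)
    rw [Real.log_div (by positivity) (by positivity)] at h1
    have h2 : (n+1+1:ℝ) * (Real.log (n+1) - Real.log (n+1+1)) ≤ -1 := by
      calc _ ≤ (n+1+1:ℝ) * ((n+1:ℝ)/(n+1+1) - 1) := by gcongr
        _ = -1 := by field_simp; ring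
    nlinarith

lemma aux_up (x : ℝ) (hx : 1 ≤ x) :
    Real.log (⌊x⌋₊.factorial) ≤ x * Real.log x - x + Real.log x + 1 := by
  have h1 : 1 ≤ ⌊x⌋₊ := (Nat.one_le_floor_iff x).2 hx
  have h2 : (⌊x⌋₊:ℝ) ≤ x := Nat.floor_le (by linarith)
  generalize ⌊x⌋₊ = m at *
  obtain ⟨n, rfl⟩ : ∃ n, m = n + 1 := ⟨m-1, by omega⟩
  refine (aux_up_nat n).trans ?_
  push_cast at h2
  have := aux_mono (n+1) x (by linarith [n.cast_nonneg (α := ℝ)]) h2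
  have := Real.log_le_log (by positivity) h2
  linarith

lemma aux_lo (x : ℝ) (hx : 1 ≤ x) :
    x * Real.log x - x - Real.log (x+1) ≤ Real.log (⌊x⌋₊.factorial) := by
  have h2 : (⌊x⌋₊:ℝ) ≤ x := Nat.floor_le (by linarith)
  have h3 : x ≤ ⌊x⌋₊ + 1 := (Nat.lt_floor_add_one x).le
  generalize ⌊x⌋₊ = n at *
  have h := Stirling.le_log_factorial_stirling (n := n+1) (by omega)
  rw [Nat.factorial_succ, Nat.cast_mul,
    Real.log_mul (x := ((n+1 : ℕ) : ℝ)) (by positivity) (by positivity)] at h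
  push_cast at h
  have h4 := aux_mono x (n+1) hx h3
  have h5 : 0 ≤ Real.log (n+1:ℝ) := Real.log_nonneg (by linarith)
  have h6 : 0 ≤ Real.log (2*Real.pi) := Real.log_nonneg (by linarith [Real.pi_gt_three])
  have h7 : Real.log (n+1:ℝ) ≤ Real.log (x+1) := Real.log_le_log (by positivity) (by linarith)
  linarith

lemma aux_theta_step (x : ℝ) (hx : 30 ≤ x) :
    Chebyshev.theta x - Chebyshev.theta (x / 6) ≤ 0.9213 * x + 5 * Real.log x + 2 := by
  refine (aux_theta_sub x).trans ?_
  have h1 := aux_up x (by linarith)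
  have h2 := aux_lo (x/2) (by linarith)
  have h3 := aux_lo (x/3) (by linarith)
  have h5 := aux_lo (x/5) (by linarith)
  have h30 := aux_up (x/30) (by linarith)
  have g2 : Real.log (x/2+1) ≤ Real.log x := Real.log_le_log (by linarith) (by linarith)
  have g3 : Real.log (x/3+1) ≤ Real.log x := Real.log_le_log (by linarith) (by linarith)
  have g5 : Real.log (x/5+1) ≤ Real.log x := Real.log_le_log (by linarith) (by linarith)
  have g30 : Real.log (x/30) ≤ Real.log x := Real.log_le_log (by linarith) (by linarith)
  have hx0 : x ≠ 0 := by linarith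
  have e30 : Real.log 30 = Real.log 2 + Real.log 3 + Real.log 5 := by
    rw [← Real.log_mul (by norm_num) (by norm_num), ← Real.log_mul (by norm_num) (by norm_num)]
    norm_num
  rw [Real.log_div hx0 (by norm_num)] at h2 h3 h5 h30 g30
  rw [e30] at h30 g30
  have l2 := Real.log_two_lt_d9
  have l3 := Real.log_three_lt_d9
  have l5 := Real.log_five_lt_d9
  have key : (Real.log 2 * (1/2-1/30) + Real.log 3 * (1/3-1/30) + Real.log 5 * (1/5-1/30)) * x
      ≤ 0.9213 * x := by
    apply mul_le_mul_of_nonneg_right _ (by linarith)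
    linarith
  linarith

lemma aux_theta (x : ℝ) (hx : 355991 ≤ x) : Chebyshev.theta x ≤ 1.108 * x := by
  have h1 := aux_theta_step x (by linarith)
  have h2 := aux_theta_step (x/6) (by linarith)
  have h3 := aux_theta_step (x/6/6) (by linarith)
  have h4 := aux_theta_step (x/6/6/6) (by linarith)
  have h5 := Chebyshev.theta_le_log4_mul_x (x := x/6/6/6/6) (by linarith)
  have g2 : Real.log (x/6) ≤ Real.log x := Real.log_le_log (by linarith) (by linarith)
  have g3 : Real.log (x/6/6) ≤ Real.log x := Real.log_le_log (by linarith) (by linarith)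
  have g4 : Real.log (x/6/6/6) ≤ Real.log x := Real.log_le_log (by linarith) (by linarith)
  have l2 := Real.log_two_lt_d9
  have l4 : Real.log 4 = 2 * Real.log 2 := by
    rw [show (4:ℝ) = 2^2 by norm_num, Real.log_pow]; norm_num
  have hl : Real.log x ≤ x / 2^19 - 1 + 19 * Real.log 2 := by
    have := Real.log_le_sub_one_of_pos (x := x/2^19) (by positivity)
    rw [Real.log_div (by linarith) (by norm_num), Real.log_pow] at this
    push_cast at this
    linarith
  have h5' : Real.log 4 * (x/6/6/6/6) ≤ 1.3863 * (x/6/6/6/6) := by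
    apply mul_le_mul_of_nonneg_right _ (by linarith)
    linarith
  norm_num at hl
  linarith

open MeasureTheory in
lemma aux_sum (σ l ρ : ℝ) (hσ : 1 / 2 < σ) (hl : 355991 ≤ l) (hlρ : l < ρ) :
    ∑ k ∈ Finset.Ioc ⌊l⌋₊ ⌊ρ⌋₊, (k:ℝ) ^ (-(2*σ)) * (if k.Prime then Real.log k else 0) ≤
      1.108 * (2 * σ) / (2 * σ - 1) * l ^ (-(2*σ) + 1) := by
  set c : ℕ → ℝ := fun k => if k.Prime then Real.log k else 0 with hc
  have hth : ∀ t : ℝ, ∑ k ∈ Finset.Icc 0 ⌊t⌋₊, c k = Chebyshev.theta t := by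
    intro t
    rw [Chebyshev.theta_eq_sum_Icc, Finset.sum_filter]
  have hd : ∀ t ∈ Set.Icc l ρ,
      HasDerivAt (fun t : ℝ => t ^ (-(2*σ))) (-(2*σ) * t ^ (-(2*σ) - 1)) t := by
    intro t ht
    exact Real.hasDerivAt_rpow_const (Or.inl (by linarith [ht.1]))
  have hcont : ∀ a : ℝ, ContinuousOn (fun t : ℝ => t ^ a) (Set.Icc l ρ) := by
    intro a t ht
    exact (Real.continuousAt_rpow_const t a (Or.inl (by linarith [ht.1]))).continuousWithinAt
  have hint : IntegrableOn (deriv (fun t : ℝ => t ^ (-(2*σ)))) (Set.Icc l ρ) := by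
    refine (((hcont (-(2*σ)-1)).const_smul (-(2*σ))).integrableOn_Icc (μ := volume)).congr_fun ?_
      measurableSet_Icc
    intro t ht
    simp only [(hd t ht).deriv, Pi.smul_apply, smul_eq_mul]
  have habel := sum_mul_eq_sub_sub_integral_mul c (f := fun t : ℝ => t ^ (-(2*σ)))
    (a := l) (b := ρ) (by linarith) hlρ.le (fun t ht => (hd t ht).differentiableAt) hint
  have hI := (integrableOn_mul_sum_Icc c (m := 0) (a := l) (b := ρ) (by linarith) hint).mono_set
    Set.Ioc_subset_Icc_self
  rw [habel]
  have hmono : -(∫ t in Set.Ioc l ρ, deriv (fun t : ℝ => t ^ (-(2*σ))) t *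
      ∑ k ∈ Finset.Icc 0 ⌊t⌋₊, c k) ≤ ∫ t in Set.Ioc l ρ, (1.108 * (2*σ)) * t ^ (-(2*σ)) := by
    rw [← integral_neg]
    refine setIntegral_mono_on hI.neg ?_ measurableSet_Ioc ?_
    · exact ((((hcont (-(2*σ))).const_smul (1.108 * (2*σ))).integrableOn_Icc
        (μ := volume)).mono_set Set.Ioc_subset_Icc_self)
    · intro t ht
      have ht' := Set.Ioc_subset_Icc_self ht
      have ht0 : 0 < t := by linarith [ht.1]
      rw [(hd t ht').deriv, hth]
      have h1 := aux_theta t (by linarith [ht.1])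
      have h2 : t ^ (-(2*σ)) = t ^ (-(2*σ) - 1) * t := by
        rw [Real.rpow_sub_one ht0.ne']; field_simp
      rw [h2]
      have h3 : 0 ≤ (2*σ) * t ^ (-(2*σ) - 1) := by
        have := Real.rpow_nonneg ht0.le (-(2*σ) - 1); positivity
      nlinarith [mul_le_mul_of_nonneg_left h1 h3]
  have hcalc : ∫ t in Set.Ioc l ρ, (1.108 * (2*σ)) * t ^ (-(2*σ)) =
      (1.108 * (2*σ)) * ((ρ ^ (-(2*σ)+1) - l ^ (-(2*σ)+1)) / (-(2*σ)+1)) := by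
    rw [← intervalIntegral.integral_of_le hlρ.le, intervalIntegral.integral_const_mul,
      integral_rpow]
    right
    refine ⟨by linarith, ?_⟩
    rw [Set.uIcc_of_le hlρ.le]
    intro h; linarith [h.1]
  rw [hth, hth]
  have hρ0 : 0 < ρ := by linarith
  have e1 : ρ ^ (-(2*σ)) * Chebyshev.theta ρ ≤ 1.108 * ρ ^ (-(2*σ)+1) := by
    rw [Real.rpow_add_one hρ0.ne']
    have := mul_le_mul_of_nonneg_left (aux_theta ρ (by linarith))
      (Real.rpow_nonneg hρ0.le (-(2*σ)))
    linarith
  have e2 : 0 ≤ l ^ (-(2*σ)) * Chebyshev.theta l :=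
    mul_nonneg (Real.rpow_nonneg (by linarith) _) (Chebyshev.theta_nonneg l)
  have e3 : 0 ≤ ρ ^ (-(2*σ)+1) := Real.rpow_nonneg hρ0.le _
  have hp : 0 < 2*σ - 1 := by linarith
  have e4 : (1.108 * (2*σ)) * ((ρ ^ (-(2*σ)+1) - l ^ (-(2*σ)+1)) / (-(2*σ)+1)) =
      1.108 * (2 * σ) / (2 * σ - 1) * l ^ (-(2*σ) + 1)
        - 1.108 * ρ ^ (-(2*σ)+1) - 1.108 / (2*σ-1) * ρ ^ (-(2*σ)+1) := by
    have : -(2*σ)+1 = -(2*σ-1) := by ring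
    generalize ρ ^ (-(2*σ)+1) = A
    generalize l ^ (-(2*σ)+1) = B
    rw [this]
    field_simp
    ring
  have e5 : 0 ≤ 1.108 / (2*σ-1) * ρ ^ (-(2*σ)+1) := by positivity
  linarith

/-- Expansion of a sum of logarithms of Euler-type factors over primes `λ < p ≤ ρ`
into the corresponding sum of first-order terms, with explicit error bound. -/
theorem stmt_4 (q : ℕ) (hq : 0 < q) [NeZero q] (χ : DirichletCharacter ℂ q)
    (σ l ρ : ℝ) (hσ : 1 / 2 < σ) (hl : 355991 ≤ l) (hlρ : l < ρ)
    (θ : ℕ → ℝ) (s : ℂ) (hs : s.re = σ) :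
    norm (E := ℂ)
      ((-(∑ p ∈ (primesUpTo ρ).filter (fun p : ℕ => l < (p : ℝ)),
          Complex.log (1 - χ (p : ZMod q) *
            Complex.exp (-(2 * Real.pi * Complex.I * (θ p))) * (p : ℂ) ^ (-s)))) -
        ∑ p ∈ (primesUpTo ρ).filter (fun p : ℕ => l < (p : ℝ)),
          χ (p : ZMod q) * Complex.exp (-(2 * Real.pi * Complex.I * (θ p))) * (p : ℂ) ^ (-s)) ≤
      1.11 * σ / (2 * σ - 1) * (1 / (l ^ (2 * σ - 1) * Real.log l)) := by
  have hl0 : 0 < l := by linarith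
  have hlog : 0 < Real.log l := Real.log_pos (by linarith)
  have hset : (primesUpTo ρ).filter (fun p : ℕ => l < (p : ℝ)) =
      (Finset.Ioc ⌊l⌋₊ ⌊ρ⌋₊).filter Nat.Prime := by
    ext p
    simp only [primesUpTo, Finset.mem_filter, Finset.mem_range, Finset.mem_Ioc,
      Nat.floor_lt hl0.le, Nat.lt_succ_iff]
    tauto
  rw [← Finset.sum_neg_distrib, ← Finset.sum_sub_distrib]
  refine (norm_sum_le _ _).trans ?_
  have hterm : ∀ p ∈ (primesUpTo ρ).filter (fun p : ℕ => l < (p : ℝ)),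
      ‖-Complex.log (1 - χ (p : ZMod q) *
            Complex.exp (-(2 * Real.pi * Complex.I * (θ p))) * (p : ℂ) ^ (-s)) -
          χ (p : ZMod q) * Complex.exp (-(2 * Real.pi * Complex.I * (θ p))) * (p : ℂ) ^ (-s)‖ ≤
      298/595/Real.log l * ((p:ℝ) ^ (-(2*σ)) * Real.log p) := by
    intro p hp
    simp only [primesUpTo, Finset.mem_filter] at hp
    obtain ⟨⟨-, hpp⟩, hlp⟩ := hp
    have hp0 : (0:ℝ) < p := by linarith
    have hz : ‖χ (p : ZMod q) * Complex.exp (-(2 * Real.pi * Complex.I * (θ p))) *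
        (p : ℂ) ^ (-s)‖ ≤ (p:ℝ) ^ (-σ) := by
      rw [norm_mul, norm_mul, Complex.norm_natCast_cpow_of_pos hpp.pos, Complex.neg_re, hs,
        Complex.norm_exp]
      have : (-(2 * Real.pi * Complex.I * (θ p)) : ℂ).re = 0 := by simp
      rw [this, Real.exp_zero, mul_one]
      exact mul_le_of_le_one_left (Real.rpow_nonneg hp0.le _) (χ.norm_le_one _)
    generalize χ (p : ZMod q) * Complex.exp (-(2 * Real.pi * Complex.I * (θ p))) *
        (p : ℂ) ^ (-s) = z at hz ⊢
    have hr : (p:ℝ) ^ (-σ) ≤ 1/596 := by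
      calc (p:ℝ) ^ (-σ) ≤ (p:ℝ) ^ (-(1/2):ℝ) :=
            Real.rpow_le_rpow_of_exponent_le (by linarith) (by linarith)
        _ = 1 / √p := by rw [Real.rpow_neg hp0.le, Real.sqrt_eq_rpow, one_div (_ ^ _)]
        _ ≤ 1/596 := by
          apply one_div_le_one_div_of_le (by norm_num)
          apply Real.le_sqrt_of_sq_le
          linarith
    have hz1 : ‖z‖ ≤ 1/596 := hz.trans hr
    have h1 := Complex.norm_log_one_add_sub_self_le (z := -z) (by rw [norm_neg]; linarith)
    rw [norm_neg] at h1
    have h2 : ‖-Complex.log (1 - z) - z‖ = ‖Complex.log (1 + -z) - -z‖ := by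
      rw [← norm_neg]; congr 1; rw [← sub_eq_add_neg]; ring
    rw [h2]
    refine h1.trans ?_
    have h3 : (1 - ‖z‖)⁻¹ ≤ 596/595 := by
      rw [inv_le_comm₀ (by linarith) (by norm_num)]; linarith
    have h4 : ‖z‖^2 ≤ (p:ℝ) ^ (-(2*σ)) := by
      calc ‖z‖^2 ≤ ((p:ℝ) ^ (-σ))^2 := by gcongr
        _ = _ := by rw [← Real.rpow_natCast, ← Real.rpow_mul hp0.le]; congr 1; push_cast; ring
    have h5 : 1 ≤ Real.log p / Real.log l := by
      rw [one_le_div hlog]; exact Real.log_le_log hl0 hlp.le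
    have h6 : 0 ≤ (p:ℝ) ^ (-(2*σ)) := Real.rpow_nonneg hp0.le _
    calc ‖z‖^2 * (1 - ‖z‖)⁻¹ / 2 ≤ (p:ℝ) ^ (-(2*σ)) * (596/595) / 2 := by
          have h7 : 0 ≤ (1 - ‖z‖)⁻¹ := inv_nonneg.2 (by linarith)
          gcongr
      _ ≤ (p:ℝ) ^ (-(2*σ)) * (596/595) / 2 * (Real.log p / Real.log l) :=
        le_mul_of_one_le_right (by positivity) h5
      _ = _ := by ring
  refine (Finset.sum_le_sum hterm).trans ?_
  rw [← Finset.mul_sum, hset, Finset.sum_filter]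
  have hS := aux_sum σ l ρ hσ hl hlρ
  simp only [mul_ite, mul_zero] at hS
  refine (mul_le_mul_of_nonneg_left hS (by positivity)).trans ?_
  have e : l ^ (-(2*σ)+1) = (l ^ (2*σ-1))⁻¹ := by
    rw [← Real.rpow_neg hl0.le]; congr 1; ring
  rw [e]
  have hP : 0 < l ^ (2*σ-1) := Real.rpow_pos_of_pos hl0 _
  have hp : 0 < 2*σ - 1 := by linarith
  have hQ : 0 ≤ σ / (2*σ-1) / (l ^ (2*σ-1) * Real.log l) := by positivity
  calc _ = (298/595*1.108*2) * (σ / (2*σ-1) / (l ^ (2*σ-1) * Real.log l)) := by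
        field_simp
    _ ≤ 1.11 * (σ / (2*σ-1) / (l ^ (2*σ-1) * Real.log l)) := by gcongr; norm_num
    _ = _ := by ring
end

section
/- Let q be 1 or a prime number and χ a Dirichlet character modulo q. Let E = {s ∈ ℂ : |s| ≤ d} with 0 < d < 1/4 and set ω = 1/4 − d. If Q > max{exp(q⁸), 355991} and T ≥ π e^{0.51(1−2ω)(Q−872)/ω}, then ∫_{T/2}^{T} ∬_E | L(s + 3/4 + iτ, χ) · L_Q(s + 3/4 + iτ, χ)^{−1} − 1 |² dτ dσ dt ≤ 0.0062 T (φ(q)/q)⁴ log² Q / (ω³ Q^{2ω}), where s = σ + it ranges over E. -/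
open MeasureTheory

section helpers
open FourierTransform


lemma gauss_K (b : ℝ) (hb : 0 < b) (t : ℝ) :
    ‖∫ ξ : ℝ, Complex.exp (Complex.I * (t:ℂ) * ξ) * Complex.exp (-(b:ℂ) * (ξ:ℂ) ^ 2)‖
      = Real.sqrt (Real.pi / b) * Real.exp (-t ^ 2 / (4 * b)) := by
  rw [fourierIntegral_gaussian (by simpa using hb), norm_mul, Complex.norm_exp]
  congr 1
  · have : ((Real.pi : ℂ) / b) = ((Real.pi / b : ℝ) : ℂ) := by push_cast; rfl
    rw [this, Complex.norm_cpow_eq_rpow_re_of_pos (by positivity), Real.sqrt_eq_rpow]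
    norm_num
  · congr 1
    have : (-(t:ℂ)^2 / (4 * (b:ℂ))) = ((-t^2/(4*b) : ℝ) : ℂ) := by push_cast; rfl
    rw [this, Complex.ofReal_re]

lemma gauss_K_int (b : ℝ) (hb : 0 < b) (x : ℝ) :
    ∫ y : ℝ, Real.sqrt (Real.pi / b) * Real.exp (-(-2 * Real.pi * (x - y)) ^ 2 / (4 * b)) = 1 := by
  have h := integral_sub_left_eq_self (fun y : ℝ => Real.sqrt (Real.pi / b) * Real.exp (-(-2 * Real.pi * y) ^ 2 / (4 * b))) volume x
  rw [h, integral_const_mul]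
  have h2 : ∀ y : ℝ, -(-2 * Real.pi * y) ^ 2 / (4 * b) = -(Real.pi ^ 2 / b) * y ^ 2 := by
    intro y; field_simp; ring
  simp_rw [h2]
  rw [integral_gaussian, ← Real.sqrt_mul (by positivity)]
  rw [Real.sqrt_eq_one]
  field_simp

lemma gauss_K_integrable (b : ℝ) (hb : 0 < b) :
    Integrable (fun y : ℝ => Real.sqrt (Real.pi / b) * Real.exp (-(-2 * Real.pi * y) ^ 2 / (4 * b))) := by
  have h2 : ∀ y : ℝ, -(-2 * Real.pi * y) ^ 2 / (4 * b) = -(Real.pi ^ 2 / b) * y ^ 2 := by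
    intro y; field_simp; ring
  simp_rw [h2]
  exact (integrable_exp_neg_mul_sq (by positivity)).const_mul _

lemma normsq_fourier (g : ℝ → ℂ) (ξ : ℝ) :
    ((‖𝓕 g ξ‖ ^ 2 : ℝ) : ℂ) = ∫ z : ℝ × ℝ, (g z.1 * starRingEnd ℂ (g z.2)) *
      Complex.exp (Complex.I * ((-2 * Real.pi * (z.1 - z.2) : ℝ) : ℂ) * ξ) := by
  have h1 : ((‖𝓕 g ξ‖ ^ 2 : ℝ) : ℂ) = 𝓕 g ξ * starRingEnd ℂ (𝓕 g ξ) := by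
    rw [Complex.mul_conj, Complex.normSq_eq_norm_sq]
  rw [h1, Real.fourier_real_eq_integral_exp_smul, ← integral_conj, ← integral_prod_mul]
  congr 1
  ext z
  simp only [smul_eq_mul, map_mul, ← Complex.exp_conj, Complex.conj_ofReal, Complex.conj_I]
  have : Complex.exp (Complex.I * ((-2 * Real.pi * (z.1 - z.2) : ℝ) : ℂ) * ξ) =
    Complex.exp (((-2 * Real.pi * z.1 * ξ : ℝ) : ℂ) * Complex.I) *
    Complex.exp (((-2 * Real.pi * z.2 * ξ : ℝ) : ℂ) * -Complex.I) := by
    rw [← Complex.exp_add]; congr 1; push_cast; ring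
  rw [this]; ring

lemma gauss_fourier_bound (g : ℝ → ℂ) (hg : Integrable g) (hg2 : Integrable (fun x => ‖g x‖ ^ 2))
    (b : ℝ) (hb : 0 < b) :
    ∫ ξ : ℝ, Real.exp (-b * ξ ^ 2) * ‖𝓕 g ξ‖ ^ 2 ≤ ∫ x, ‖g x‖ ^ 2 := by
  set K : ℝ → ℝ := fun y => Real.sqrt (Real.pi / b) * Real.exp (-(-2 * Real.pi * y) ^ 2 / (4 * b)) with hK
  have hKpos : ∀ y, 0 ≤ K y := fun y => by simp only [hK]; positivity
  have hKint : Integrable K := gauss_K_integrable b hb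
  have hK1 : ∀ x, ∫ y, K (x - y) = 1 := gauss_K_int b hb
  have hK1' : ∀ x, ∫ y, K (y - x) = 1 := by
    intro x; rw [← hK1 x]; congr 1; ext y; simp only [hK]; ring_nf
  have hprod : Integrable (fun z : ℝ × ℝ => g z.1 * starRingEnd ℂ (g z.2)) := by
    have hg' : Integrable (fun y => starRingEnd ℂ (g y)) :=
      (Complex.conjLIE.toContinuousLinearEquiv.toContinuousLinearMap.integrable_comp hg)
    exact hg.mul_prod hg'
  have hgi : Integrable (fun ξ : ℝ => Complex.exp (-(b:ℂ) * (ξ:ℂ) ^ 2)) :=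
    integrable_cexp_neg_mul_sq (by simpa using hb)
  have e1 : ((∫ ξ : ℝ, Real.exp (-b * ξ ^ 2) * ‖𝓕 g ξ‖ ^ 2 : ℝ) : ℂ) =
      ∫ z : ℝ × ℝ, (g z.1 * starRingEnd ℂ (g z.2)) *
        ∫ ξ : ℝ, Complex.exp (Complex.I * ((-2 * Real.pi * (z.1 - z.2) : ℝ) : ℂ) * ξ) *
          Complex.exp (-(b:ℂ) * (ξ:ℂ) ^ 2) := by
    rw [← integral_complex_ofReal]
    have : ∀ ξ : ℝ, ((Real.exp (-b * ξ ^ 2) * ‖𝓕 g ξ‖ ^ 2 : ℝ) : ℂ) =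
      ∫ z : ℝ × ℝ, (g z.1 * starRingEnd ℂ (g z.2)) *
        (Complex.exp (Complex.I * ((-2 * Real.pi * (z.1 - z.2) : ℝ) : ℂ) * ξ) *
          Complex.exp (-(b:ℂ) * (ξ:ℂ) ^ 2)) := by
      intro ξ
      rw [Complex.ofReal_mul, normsq_fourier, ← integral_const_mul]
      congr 1; ext z
      push_cast
      ring
    simp_rw [this]
    rw [integral_integral_swap]
    · congr 1; ext z; rw [integral_const_mul]
    · have h3 := hgi.mul_prod hprod
      have h4 : Integrable (fun z : ℝ × (ℝ × ℝ) => Complex.exp (Complex.I * ((-2 * Real.pi * (z.2.1 - z.2.2) : ℝ) : ℂ) * z.1) * (Complex.exp (-(b:ℂ) * (z.1:ℂ) ^ 2) * (g z.2.1 * starRingEnd ℂ (g z.2.2)))) (volume.prod volume) := by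
        refine h3.bdd_mul (c := 1) ?_ ?_
        · exact Continuous.aestronglyMeasurable (by fun_prop)
        · refine Filter.Eventually.of_forall fun z => ?_
          have : Complex.I * ((-2 * Real.pi * (z.2.1 - z.2.2) : ℝ) : ℂ) * z.1 = ((-2 * Real.pi * (z.2.1 - z.2.2) * z.1 : ℝ) : ℂ) * Complex.I := by push_cast; ring
          rw [this, Complex.norm_exp_ofReal_mul_I]
      refine h4.congr (Filter.Eventually.of_forall fun z => ?_)
      simp only [Function.uncurry]
      ring
  have hL : ∫ ξ : ℝ, Real.exp (-b * ξ ^ 2) * ‖𝓕 g ξ‖ ^ 2 =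
      ‖((∫ ξ : ℝ, Real.exp (-b * ξ ^ 2) * ‖𝓕 g ξ‖ ^ 2 : ℝ) : ℂ)‖ := by
    rw [Complex.norm_real, Real.norm_of_nonneg]
    exact integral_nonneg fun ξ => by positivity
  rw [hL, e1]
  -- symmetric majorants
  have hI1 : Integrable (fun z : ℝ × ℝ => ‖g z.1‖ ^ 2 * K (z.1 - z.2)) (volume.prod volume) := by
    rw [integrable_prod_iff]
    · refine ⟨Filter.Eventually.of_forall fun x => ?_, ?_⟩
      · exact ((hKint.comp_sub_left x).const_mul (‖g x‖ ^ 2))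
      · have : ∀ x, ∫ y, ‖‖g x‖ ^ 2 * K (x - y)‖ = ‖g x‖ ^ 2 := by
          intro x
          have : ∀ y, ‖‖g x‖ ^ 2 * K (x - y)‖ = ‖g x‖ ^ 2 * K (x - y) := fun y =>
            Real.norm_of_nonneg (mul_nonneg (by positivity) (hKpos _))
          simp_rw [this]
          rw [integral_const_mul, hK1, mul_one]
        simp_rw [this]
        exact hg2
    · refine AEStronglyMeasurable.mul ?_ ?_
      · exact hg2.aestronglyMeasurable.comp_fst
      · exact Continuous.aestronglyMeasurable (by simp only [hK]; fun_prop)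
  have hI2 : Integrable (fun z : ℝ × ℝ => ‖g z.2‖ ^ 2 * K (z.1 - z.2)) (volume.prod volume) := by
    have := hI1.swap
    refine this.congr (Filter.Eventually.of_forall fun z => ?_)
    simp only [Function.comp, Prod.swap, hK]
    ring_nf
  have hv1 : ∫ z : ℝ × ℝ, ‖g z.1‖ ^ 2 * K (z.1 - z.2) = ∫ x, ‖g x‖ ^ 2 := by
    rw [Measure.volume_eq_prod, integral_prod _ hI1]
    congr 1; ext x; dsimp only; rw [integral_const_mul, hK1, mul_one]
  have hv2 : ∫ z : ℝ × ℝ, ‖g z.2‖ ^ 2 * K (z.1 - z.2) = ∫ x, ‖g x‖ ^ 2 := by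
    rw [Measure.volume_eq_prod, integral_prod_symm _ hI2]
    congr 1; ext x; dsimp only; rw [integral_const_mul, hK1', mul_one]
  calc _ ≤ ∫ z : ℝ × ℝ, (1/2) * (‖g z.1‖ ^ 2 * K (z.1 - z.2)) + (1/2) * (‖g z.2‖ ^ 2 * K (z.1 - z.2)) := by
        refine norm_integral_le_of_norm_le ((hI1.const_mul _).add (hI2.const_mul _)) (Filter.Eventually.of_forall fun z => ?_)
        rw [norm_mul, gauss_K b hb, norm_mul, RCLike.norm_conj]
        have := hKpos (z.1 - z.2)
        change ‖g z.1‖ * ‖g z.2‖ * K (z.1 - z.2) ≤ _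
        nlinarith [mul_nonneg (sq_nonneg (‖g z.1‖ - ‖g z.2‖)) this]
    _ = ∫ x, ‖g x‖ ^ 2 := by
        have := integral_add (hI1.const_mul (1/2)) (hI2.const_mul (1/2))
        rw [← Measure.volume_eq_prod] at this
        rw [this, integral_const_mul, integral_const_mul, hv1, hv2]
        ring

lemma plancherel_le (g : ℝ → ℂ) (hg : Integrable g) (hg2 : Integrable (fun x => ‖g x‖ ^ 2))
    (X : ℝ) (hX : 0 < X) :
    ∫ ξ in Set.Icc (-X) X, ‖𝓕 g ξ‖ ^ 2 ≤ 3 * ∫ x, ‖g x‖ ^ 2 := by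
  have hb : (0:ℝ) < 1 / X ^ 2 := by positivity
  have hc : Continuous (𝓕 g) :=
    VectorFourier.fourierIntegral_continuous Real.continuous_fourierChar (by fun_prop) hg
  have hbd : ∀ ξ, ‖𝓕 g ξ‖ ≤ ∫ x, ‖g x‖ := fun ξ => VectorFourier.norm_fourierIntegral_le_integral_norm _ _ _ _ _
  have hint : Integrable (fun ξ : ℝ => Real.exp (-(1 / X ^ 2) * ξ ^ 2) * ‖𝓕 g ξ‖ ^ 2) := by
    have := (integrable_exp_neg_mul_sq hb).bdd_mul (f := fun ξ => ‖𝓕 g ξ‖ ^ 2) (c := (∫ x, ‖g x‖) ^ 2) (by fun_prop) (Filter.Eventually.of_forall fun ξ => by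
      rw [norm_pow, norm_norm]; gcongr; exact hbd ξ)
    refine this.congr (Filter.Eventually.of_forall fun z => ?_)
    ring
  have h1 := gauss_fourier_bound g hg hg2 _ hb
  have h2 : ∫ ξ in Set.Icc (-X) X, ‖𝓕 g ξ‖ ^ 2 ≤ ∫ ξ in Set.Icc (-X) X, 3 * (Real.exp (-(1 / X ^ 2) * ξ ^ 2) * ‖𝓕 g ξ‖ ^ 2) := by
    refine setIntegral_mono_on ?_ (hint.const_mul 3).integrableOn measurableSet_Icc ?_
    · exact (by fun_prop : Continuous fun ξ => ‖𝓕 g ξ‖ ^ 2).continuousOn.integrableOn_Icc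
    · intro ξ hξ
      have hsq : ξ ^ 2 ≤ X ^ 2 := sq_le_sq' hξ.1 hξ.2
      have h3 : Real.exp (-1) ≤ Real.exp (-(1 / X ^ 2) * ξ ^ 2) := by
        apply Real.exp_le_exp.mpr
        have : 1 / X ^ 2 * ξ ^ 2 ≤ 1 := by
          rw [one_div, inv_mul_le_iff₀ (by positivity)]; linarith
        linarith
      have h4 : 1 / 3 ≤ Real.exp (-1) := by
        rw [Real.exp_neg, one_div]
        exact inv_anti₀ (Real.exp_pos _) (by linarith [Real.exp_one_lt_d9])
      nlinarith [sq_nonneg ‖𝓕 g ξ‖]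
  have h5 : ∫ ξ in Set.Icc (-X) X, 3 * (Real.exp (-(1 / X ^ 2) * ξ ^ 2) * ‖𝓕 g ξ‖ ^ 2) ≤ ∫ ξ, 3 * (Real.exp (-(1 / X ^ 2) * ξ ^ 2) * ‖𝓕 g ξ‖ ^ 2) :=
    setIntegral_le_integral (hint.const_mul 3) (Filter.Eventually.of_forall fun ξ => by dsimp; positivity)
  rw [integral_const_mul (r := (3:ℝ)) (μ := volume)] at h5
  linarith

/-- Partial sums of a bounded periodic function. -/
lemma periodic_range (q : ℕ) (hq : 0 < q) (f : ℕ → ℂ) (hf : ∀ n, f (n + q) = f n)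
    (hb : ∀ n, ‖f n‖ ≤ 1) :
    ∃ κ : ℂ, ‖κ‖ ≤ 1 ∧ ∀ n, ‖∑ k ∈ Finset.range n, f k - κ * n‖ ≤ 2 * q := by
  have hq' : (q : ℂ) ≠ 0 := by exact_mod_cast hq.ne'
  have hsum : ∀ n, ‖∑ k ∈ Finset.range n, f k‖ ≤ n := fun n => by
    refine (norm_sum_le _ _).trans ((Finset.sum_le_sum fun k _ => hb k).trans ?_)
    simp
  set κ : ℂ := (∑ k ∈ Finset.range q, f k) / q with hκ
  have hκ1 : ‖κ‖ ≤ 1 := by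
    rw [hκ, norm_div, Complex.norm_natCast]
    exact div_le_one_of_le₀ (hsum q) (by positivity)
  refine ⟨κ, hκ1, ?_⟩
  have hper : ∀ n, ∑ k ∈ Finset.range (n + q), f k - κ * ((n + q : ℕ) : ℂ) = ∑ k ∈ Finset.range n, f k - κ * n := by
    intro n
    rw [add_comm n q, Finset.sum_range_add]
    have : ∑ x ∈ Finset.range n, f (q + x) = ∑ x ∈ Finset.range n, f x := by
      refine Finset.sum_congr rfl fun x _ => ?_
      rw [add_comm, hf]
    rw [this]
    have h2 : κ * q = ∑ k ∈ Finset.range q, f k := by rw [hκ]; field_simp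
    push_cast
    linear_combination -h2
  intro n
  induction n using Nat.strong_induction_on with
  | _ n ih =>
    by_cases h : n < q
    · refine (norm_sub_le _ _).trans ?_
      rw [norm_mul, Complex.norm_natCast]
      have h1 : (n : ℝ) ≤ q := by exact_mod_cast h.le
      have := hsum n
      nlinarith [norm_nonneg κ, (Nat.cast_nonneg n : (0:ℝ) ≤ n)]
    · obtain ⟨m, rfl⟩ := Nat.exists_eq_add_of_le (not_lt.mp h)
      rw [add_comm q m, hper]
      exact ih m (by omega)

lemma periodic_sum (q : ℕ) (hq : 0 < q) (f : ℕ → ℂ) (hf : ∀ n, f (n + q) = f n)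
    (hb : ∀ n, ‖f n‖ ≤ 1) :
    ∃ κ : ℂ, ∀ u : ℝ, 0 ≤ u → ‖∑ k ∈ Finset.Icc 1 ⌊u⌋₊, f k - κ * u‖ ≤ 4 * q := by
  obtain ⟨κ, hκ, h⟩ := periodic_range q hq f hf hb
  refine ⟨κ, fun u hu => ?_⟩
  have h1 : ∑ k ∈ Finset.Icc 1 ⌊u⌋₊, f k = ∑ k ∈ Finset.range (⌊u⌋₊ + 1), f k - f 0 := by
    rw [Finset.sum_range_succ', add_sub_cancel_right, Finset.range_eq_Ico, Finset.sum_Ico_add' f 0 _ 1]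
    rfl
  have h2 := h (⌊u⌋₊ + 1)
  have h3 : ∑ k ∈ Finset.Icc 1 ⌊u⌋₊, f k - κ * u =
     (∑ k ∈ Finset.range (⌊u⌋₊ + 1), f k - κ * ((⌊u⌋₊ + 1 : ℕ) : ℂ)) + κ * ((⌊u⌋₊ + 1 - u : ℝ) : ℂ) - f 0 := by
    rw [h1]; push_cast; ring
  rw [h3]
  have h4 : ‖κ * ((⌊u⌋₊ + 1 - u : ℝ) : ℂ)‖ ≤ 1 := by
    rw [norm_mul, Complex.norm_real]
    have h5 : ‖(⌊u⌋₊ + 1 - u : ℝ)‖ ≤ 1 := by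
      rw [Real.norm_eq_abs, abs_le]
      have := Nat.floor_le hu
      have := Nat.lt_floor_add_one u
      constructor <;> linarith
    nlinarith [norm_nonneg κ, norm_nonneg (⌊u⌋₊ + 1 - u : ℝ)]
  have hq1 : (1:ℝ) ≤ q := by exact_mod_cast hq
  refine (norm_sub_le _ _).trans ?_
  refine (add_le_add (norm_add_le _ _) (hb 0)).trans ?_
  linarith

/-- Sieving by a finite set of primes. -/
lemma sieve_sum (f : ℕ → ℂ) (c : ℕ → ℂ) (hc : ∀ p, p.Prime → ‖c p‖ ≤ 1)
    (hmul : ∀ p m, p.Prime → f (p * m) = c p * f m) (C : ℝ) 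
    (hbase : ∃ κ : ℂ, ∀ u : ℝ, 0 ≤ u → ‖∑ k ∈ Finset.Icc 1 ⌊u⌋₊, f k - κ * u‖ ≤ C)
    (S : Finset ℕ) (hS : ∀ p ∈ S, p.Prime) :
    ∃ κ : ℂ, ∀ u : ℝ, 0 ≤ u →
      ‖∑ k ∈ Finset.Icc 1 ⌊u⌋₊, (if ∀ p ∈ S, ¬ p ∣ k then f k else 0) - κ * u‖ ≤ 2 ^ S.card * C := by
  classical
  induction S using Finset.induction_on with
  | empty => simpa using hbase
  | insert p S hp ih =>
    obtain ⟨κ, hκ⟩ := ih (fun r hr => hS r (Finset.mem_insert_of_mem hr))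
    have pp : p.Prime := hS p (Finset.mem_insert_self _ _)
    have p0 : (0:ℝ) < p := by exact_mod_cast pp.pos
    refine ⟨κ - c p * κ / p, fun u hu => ?_⟩
    set F : ℕ → ℂ := fun k => if ∀ p ∈ S, ¬ p ∣ k then f k else 0 with hF
    have hFmul : ∀ m, F (p * m) = c p * F m := by
      intro m
      have : (∀ r ∈ S, ¬ r ∣ p * m) ↔ (∀ r ∈ S, ¬ r ∣ m) := by
        refine forall₂_congr fun r hr => not_congr ?_
        have rp : r.Prime := hS r (Finset.mem_insert_of_mem hr)
        rw [rp.dvd_mul, Nat.prime_dvd_prime_iff_eq rp pp]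
        constructor
        · rintro (h | h)
          · exact absurd (h ▸ hr) hp
          · exact h
        · exact Or.inr
      simp only [hF, this]
      split_ifs
      · exact hmul p m pp
      · simp
    have hsplit : ∑ k ∈ Finset.Icc 1 ⌊u⌋₊, (if ∀ r ∈ insert p S, ¬ r ∣ k then f k else 0) =
        ∑ k ∈ Finset.Icc 1 ⌊u⌋₊, F k - c p * ∑ k ∈ Finset.Icc 1 ⌊u / p⌋₊, F k := by
      have h1 : ∀ k, (if ∀ r ∈ insert p S, ¬ r ∣ k then f k else 0) = F k - if p ∣ k then F k else 0 := by
        intro k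
        simp only [hF, Finset.forall_mem_insert]
        by_cases h : p ∣ k <;> simp [h]
      simp_rw [h1]
      rw [Finset.sum_sub_distrib, ← Finset.sum_filter (fun k => p ∣ k) F, Finset.mul_sum]
      congr 1
      symm
      refine Finset.sum_bij (fun m _ => p * m) ?_ ?_ ?_ ?_
      · intro m hm
        rw [Finset.mem_Icc] at hm
        rw [Finset.mem_filter, Finset.mem_Icc]
        refine ⟨⟨Nat.mul_pos pp.pos hm.1, ?_⟩, dvd_mul_right _ _⟩
        apply Nat.le_floor
        have := (Nat.le_floor_iff (by positivity)).mp hm.2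
        rw [le_div_iff₀ p0] at this
        push_cast; linarith
      · intro a _ b _ h
        exact Nat.eq_of_mul_eq_mul_left pp.pos h
      · intro k hk
        rw [Finset.mem_filter, Finset.mem_Icc] at hk
        obtain ⟨⟨hk1, hk2⟩, m, rfl⟩ := hk
        refine ⟨m, ?_, rfl⟩
        rw [Finset.mem_Icc]
        refine ⟨Nat.pos_of_mul_pos_left hk1, ?_⟩
        apply Nat.le_floor
        have := (Nat.le_floor_iff hu).mp hk2
        rw [le_div_iff₀ p0]
        push_cast at this; linarith
      · intro m _
        exact (hFmul m).symm
    rw [hsplit]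
    have e : ∑ k ∈ Finset.Icc 1 ⌊u⌋₊, F k - c p * ∑ k ∈ Finset.Icc 1 ⌊u / p⌋₊, F k - (κ - c p * κ / p) * u =
       (∑ k ∈ Finset.Icc 1 ⌊u⌋₊, F k - κ * u) - c p * (∑ k ∈ Finset.Icc 1 ⌊u / p⌋₊, F k - κ * ((u / p : ℝ) : ℂ)) := by
      push_cast; ring
    rw [e]
    refine (norm_sub_le _ _).trans ?_
    rw [norm_mul, Finset.card_insert_of_notMem hp, pow_succ]
    have h1 := hκ u hu
    have h2 := hκ (u / p) (by positivity)
    have h3 := hc p pp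
    nlinarith [norm_nonneg (c p), norm_nonneg (∑ k ∈ Finset.Icc 1 ⌊u / p⌋₊, F k - κ * ((u / p : ℝ) : ℂ))]

lemma harm_bound (n N : ℕ) (hn : 2 ≤ n) (hN : n ≤ N) :
    ∑ m ∈ (Finset.Icc 2 N).filter (· < n), (1 / (m:ℝ) + 1 / ((n:ℝ) - m)) ≤ 2 * (1 + Real.log N) := by
  have hsub : (Finset.Icc 2 N).filter (· < n) ⊆ Finset.Ico 1 n := by
    intro m hm
    simp only [Finset.mem_filter, Finset.mem_Icc, Finset.mem_Ico] at hm ⊢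
    omega
  have hH : ∑ m ∈ Finset.Ico 1 n, 1 / (m:ℝ) ≤ 1 + Real.log N := by
    have h1 := harmonic_le_one_add_log (n - 1)
    have h2 : ((harmonic (n - 1) : ℚ) : ℝ) = ∑ m ∈ Finset.Ico 1 n, 1 / (m:ℝ) := by
      rw [harmonic, Finset.sum_Ico_eq_sum_range]
      push_cast
      refine Finset.sum_congr rfl fun i _ => ?_
      rw [one_div, add_comm]
    rw [← h2]
    refine h1.trans ?_
    have : ((n - 1 : ℕ) : ℝ) ≤ N := by exact_mod_cast (by omega)
    have h3 : (0:ℝ) < ((n - 1 : ℕ) : ℝ) := by exact_mod_cast (by omega)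
    linarith [Real.log_le_log h3 this]
  have hH2 : ∑ m ∈ Finset.Ico 1 n, 1 / ((n:ℝ) - m) = ∑ m ∈ Finset.Ico 1 n, 1 / (m:ℝ) := by
    refine Finset.sum_bij' (fun m _ => n - m) (fun m _ => n - m) ?_ ?_ ?_ ?_ ?_
    · intro m hm; rw [Finset.mem_Ico] at hm ⊢; omega
    · intro m hm; rw [Finset.mem_Ico] at hm ⊢; omega
    · intro m hm; rw [Finset.mem_Ico] at hm; omega
    · intro m hm; rw [Finset.mem_Ico] at hm; omega
    · intro m hm; rw [Finset.mem_Ico] at hm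
      rw [Nat.cast_sub hm.2.le]
  calc _ ≤ ∑ m ∈ Finset.Ico 1 n, (1 / (m:ℝ) + 1 / ((n:ℝ) - m)) := by
        refine Finset.sum_le_sum_of_subset_of_nonneg hsub fun m hm _ => ?_
        rw [Finset.mem_Ico] at hm
        have : (m:ℝ) < n := by exact_mod_cast hm.2
        have : 0 < (n:ℝ) - m := by linarith
        positivity
    _ ≤ _ := by rw [Finset.sum_add_distrib, hH2]; linarith

lemma exp_int_bound (l A B : ℝ) (hl : l ≠ 0) (hAB : A ≤ B) :
    ‖∫ t in Set.Icc A B, Complex.exp (Complex.I * l * t)‖ ≤ 2 / |l| := by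
  rw [integral_Icc_eq_integral_Ioc, ← intervalIntegral.integral_of_le hAB]
  have hne : Complex.I * (l:ℂ) ≠ 0 := mul_ne_zero Complex.I_ne_zero (by exact_mod_cast hl)
  rw [integral_exp_mul_complex hne, norm_div]
  have h1 : ∀ t : ℝ, ‖Complex.exp (Complex.I * l * t)‖ = 1 := by
    intro t
    have : Complex.I * (l:ℂ) * t = ((l * t : ℝ) : ℂ) * Complex.I := by push_cast; ring
    rw [this, Complex.norm_exp_ofReal_mul_I]
  have h2 : ‖Complex.I * (l:ℂ)‖ = |l| := by simp
  rw [h2]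
  gcongr
  refine (norm_sub_le _ _).trans ?_
  rw [h1, h1]; norm_num

lemma log_diff_lower (m n : ℕ) (hm : 1 ≤ m) (hmn : m < n) :
    ((n:ℝ) - m) / n ≤ Real.log n - Real.log m := by
  have hm0 : (0:ℝ) < m := by exact_mod_cast hm
  have hn0 : (0:ℝ) < n := by exact_mod_cast (by omega : 0 < n)
  have := Real.add_one_le_exp (-(Real.log n - Real.log m))
  have h := Real.log_le_sub_one_of_pos (div_pos hm0 hn0)
  rw [Real.log_div hm0.ne' hn0.ne'] at h
  have : ((n:ℝ) - m) / n = 1 - m / n := by field_simp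
  linarith

lemma off_bound (m n : ℕ) (hm : 1 ≤ m) (hmn : m < n) (σ : ℝ) (hσ1 : σ ≤ 1) :
    (m:ℝ) ^ (-σ) * (n:ℝ) ^ (-σ) * (2 / |Real.log n - Real.log m|) ≤
      2 * (n:ℝ) ^ (1 - 2 * σ) * (1 / (m:ℝ) + 1 / ((n:ℝ) - m)) := by
  have hm0 : (0:ℝ) < m := by exact_mod_cast hm
  have hn0 : (0:ℝ) < n := by exact_mod_cast (by omega : 0 < n)
  have hlt : (m:ℝ) < n := by exact_mod_cast hmn
  have hd : (0:ℝ) < (n:ℝ) - m := by linarith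
  have h1 := log_diff_lower m n hm hmn
  have h2 : 2 / |Real.log n - Real.log m| ≤ 2 / (((n:ℝ) - m) / n) := by
    have : 0 < ((n:ℝ) - m) / n := by positivity
    rw [abs_of_pos (by linarith)]
    gcongr
  have h3 : (m:ℝ) ^ (-σ) * (n:ℝ) ^ (-σ) * (2 / (((n:ℝ) - m) / n)) =
      2 * ((m:ℝ) ^ (1 - σ) * (n:ℝ) ^ (-σ)) * (1 / (m:ℝ) + 1 / ((n:ℝ) - m)) := by
    have : (m:ℝ) ^ (1 - σ) = m * (m:ℝ) ^ (-σ) := by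
      rw [sub_eq_add_neg, Real.rpow_add hm0, Real.rpow_one]
    rw [this]
    field_simp
    ring
  have h4 : (m:ℝ) ^ (1 - σ) * (n:ℝ) ^ (-σ) ≤ (n:ℝ) ^ (1 - 2 * σ) := by
    have : (n:ℝ) ^ (1 - 2 * σ) = (n:ℝ) ^ (1 - σ) * (n:ℝ) ^ (-σ) := by
      rw [← Real.rpow_add hn0]; congr 1; ring
    rw [this]
    gcongr
  calc _ ≤ (m:ℝ) ^ (-σ) * (n:ℝ) ^ (-σ) * (2 / (((n:ℝ) - m) / n)) := by gcongr
    _ = _ := h3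
    _ ≤ _ := by gcongr

lemma cpow_split (n : ℕ) (hn : 1 ≤ n) (σ t : ℝ) :
    (n:ℂ) ^ (-((σ:ℂ) + t * Complex.I)) = (((n:ℝ) ^ (-σ) : ℝ) : ℂ) * Complex.exp (Complex.I * ((-Real.log n : ℝ) : ℂ) * t) := by
  have hn0 : (n:ℂ) ≠ 0 := by exact_mod_cast (by omega : n ≠ 0)
  have hn1 : (0:ℝ) < n := by exact_mod_cast hn
  rw [neg_add, Complex.cpow_add _ _ hn0]
  congr 1
  · rw [Complex.ofReal_cpow hn1.le]; push_cast; rfl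
  · rw [Complex.cpow_def_of_ne_zero hn0, ← Complex.natCast_log]
    congr 1; push_cast; ring

lemma poly_mean (N : ℕ) (a : ℕ → ℂ) (ha : ∀ n, ‖a n‖ ≤ 1) (σ : ℝ) (hσ1 : σ ≤ 1) (A B : ℝ) (hAB : A ≤ B) :
    ∫ t in Set.Icc A B, ‖∑ n ∈ Finset.Icc 2 N, a n * (n:ℂ) ^ (-((σ:ℂ) + t * Complex.I))‖ ^ 2 ≤
      (B - A) * ∑ n ∈ Finset.Icc 2 N, ‖a n‖ ^ 2 * (n:ℝ) ^ (-(2 * σ)) +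
        8 * (1 + Real.log N) * ∑ n ∈ Finset.Icc 2 N, (n:ℝ) ^ (1 - 2 * σ) := by
  set b : ℕ → ℂ := fun n => a n * (((n:ℝ) ^ (-σ) : ℝ) : ℂ) with hb
  have hbn : ∀ n, ‖b n‖ = ‖a n‖ * (n:ℝ) ^ (-σ) := by
    intro n
    rw [hb, norm_mul, Complex.norm_real, Real.norm_of_nonneg (by positivity)]
  have hbn' : ∀ n, ‖b n‖ ≤ (n:ℝ) ^ (-σ) := by
    intro n
    rw [hbn]
    have : (0:ℝ) ≤ (n:ℝ) ^ (-σ) := by positivity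
    nlinarith [ha n]
  have hexp : ∀ t : ℝ, ((‖∑ n ∈ Finset.Icc 2 N, a n * (n:ℂ) ^ (-((σ:ℂ) + t * Complex.I))‖ ^ 2 : ℝ) : ℂ) =
      ∑ m ∈ Finset.Icc 2 N, ∑ n ∈ Finset.Icc 2 N, (b m * starRingEnd ℂ (b n)) *
        Complex.exp (Complex.I * ((Real.log n - Real.log m : ℝ) : ℂ) * t) := by
    intro t
    have h1 : ∑ n ∈ Finset.Icc 2 N, a n * (n:ℂ) ^ (-((σ:ℂ) + t * Complex.I)) =
      ∑ n ∈ Finset.Icc 2 N, b n * Complex.exp (Complex.I * ((-Real.log n : ℝ) : ℂ) * t) := by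
      refine Finset.sum_congr rfl fun n hn => ?_
      rw [Finset.mem_Icc] at hn
      rw [cpow_split n (by omega), hb]; ring
    rw [h1]
    rw [← Complex.normSq_eq_norm_sq, ← Complex.mul_conj, map_sum, Finset.sum_mul_sum]
    refine Finset.sum_congr rfl fun m _ => Finset.sum_congr rfl fun n _ => ?_
    rw [map_mul, ← Complex.exp_conj]
    simp only [map_mul, Complex.conj_I, Complex.conj_ofReal]
    have : Complex.exp (Complex.I * ((Real.log n - Real.log m : ℝ) : ℂ) * t) =
      Complex.exp (Complex.I * ((-Real.log m : ℝ) : ℂ) * t) * Complex.exp (-Complex.I * ((-Real.log n : ℝ) : ℂ) * t) := by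
      rw [← Complex.exp_add]; congr 1; push_cast; ring
    rw [this]; ring
  have hint : ((∫ t in Set.Icc A B, ‖∑ n ∈ Finset.Icc 2 N, a n * (n:ℂ) ^ (-((σ:ℂ) + t * Complex.I))‖ ^ 2 : ℝ) : ℂ) =
      ∑ m ∈ Finset.Icc 2 N, ∑ n ∈ Finset.Icc 2 N, (b m * starRingEnd ℂ (b n)) *
        ∫ t in Set.Icc A B, Complex.exp (Complex.I * ((Real.log n - Real.log m : ℝ) : ℂ) * t) := by
    rw [← integral_complex_ofReal]
    simp_rw [hexp]
    have hI : ∀ m n : ℕ, IntegrableOn (fun t : ℝ => (b m * starRingEnd ℂ (b n)) *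
        Complex.exp (Complex.I * ((Real.log n - Real.log m : ℝ) : ℂ) * t)) (Set.Icc A B) := fun m n =>
      Continuous.integrableOn_Icc (by fun_prop)
    rw [integral_finsetSum]
    · refine Finset.sum_congr rfl fun m _ => ?_
      rw [integral_finsetSum _ fun n _ => hI m n]
      refine Finset.sum_congr rfl fun n _ => ?_
      rw [integral_const_mul]
    · intro m _
      exact integrable_finsetSum _ fun n _ => hI m n
  have hnn : ∫ t in Set.Icc A B, ‖∑ n ∈ Finset.Icc 2 N, a n * (n:ℂ) ^ (-((σ:ℂ) + t * Complex.I))‖ ^ 2 =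
     ‖((∫ t in Set.Icc A B, ‖∑ n ∈ Finset.Icc 2 N, a n * (n:ℂ) ^ (-((σ:ℂ) + t * Complex.I))‖ ^ 2 : ℝ) : ℂ)‖ := by
    rw [Complex.norm_real, Real.norm_of_nonneg]
    exact integral_nonneg fun t => by positivity
  rw [hnn, hint]
  set E : ℕ → ℕ → ℝ := fun m n => if m < n then 2 * (n:ℝ) ^ (1 - 2 * σ) * (1 / (m:ℝ) + 1 / ((n:ℝ) - m)) else 0 with hE
  set D : ℕ → ℕ → ℝ := fun m n => if m = n then (B - A) * (‖a n‖ ^ 2 * (n:ℝ) ^ (-(2 * σ))) else 0 with hD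
  have key : ∀ m ∈ Finset.Icc 2 N, ∀ n ∈ Finset.Icc 2 N, ‖(b m * starRingEnd ℂ (b n)) *
        ∫ t in Set.Icc A B, Complex.exp (Complex.I * ((Real.log n - Real.log m : ℝ) : ℂ) * t)‖ ≤
        D m n + E m n + E n m := by
    intro m hm n hn
    rw [Finset.mem_Icc] at hm hn
    rw [norm_mul, norm_mul, RCLike.norm_conj]
    rcases lt_trichotomy m n with h | h | h
    · have h1 := off_bound m n (by omega) h σ hσ1
      have hne : Real.log n - Real.log m ≠ 0 := by
        have := log_diff_lower m n (by omega) h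
        have hlt : (m:ℝ) < n := by exact_mod_cast h
        have : 0 < ((n:ℝ) - m) / n := div_pos (by linarith) (by exact_mod_cast (by omega : 0 < n))
        linarith
      have h2 := exp_int_bound _ A B hne hAB
      simp only [hD, hE, h, h.ne, not_lt.mpr h.le, if_true, if_false, zero_add, add_zero]
      refine le_trans ?_ h1
      gcongr
      · exact hbn' m
      · exact hbn' n
    · subst h
      simp only [hD, hE, lt_irrefl, if_true, if_false, add_zero, sub_self]
      have : ∫ t in Set.Icc A B, Complex.exp (Complex.I * ((0:ℝ):ℂ) * (t:ℂ)) = ((B - A : ℝ) : ℂ) := by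
        simp [hAB]
      rw [this, Complex.norm_real, Real.norm_of_nonneg (by linarith), hbn]
      have : (m:ℝ) ^ (-(2 * σ)) = (m:ℝ) ^ (-σ) * (m:ℝ) ^ (-σ) := by
        rw [← Real.rpow_add (by exact_mod_cast (by omega : 0 < m))]; congr 1; ring
      rw [this]
      apply le_of_eq; ring
    · have h1 := off_bound n m (by omega) h σ hσ1
      have hne : Real.log n - Real.log m ≠ 0 := by
        have := log_diff_lower n m (by omega) h
        have hlt : (n:ℝ) < m := by exact_mod_cast h
        have : 0 < ((m:ℝ) - n) / m := div_pos (by linarith) (by exact_mod_cast (by omega : 0 < m))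
        linarith
      have h2 := exp_int_bound _ A B hne hAB
      rw [abs_sub_comm] at h2
      simp only [hD, hE, h, h.ne', not_lt.mpr h.le, if_true, if_false, zero_add]
      refine le_trans ?_ h1
      rw [mul_comm ‖b m‖]
      gcongr
      · exact hbn' n
      · exact hbn' m
  have hEsum : ∑ n ∈ Finset.Icc 2 N, ∑ m ∈ Finset.Icc 2 N, E m n ≤ 4 * (1 + Real.log N) * ∑ n ∈ Finset.Icc 2 N, (n:ℝ) ^ (1 - 2 * σ) := by
    rw [Finset.mul_sum]
    refine Finset.sum_le_sum fun n hn => ?_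
    rw [Finset.mem_Icc] at hn
    simp only [hE]
    rw [← Finset.sum_filter, ← Finset.mul_sum]
    have := harm_bound n N hn.1 hn.2
    have h0 : (0:ℝ) ≤ (n:ℝ) ^ (1 - 2 * σ) := by positivity
    nlinarith
  calc _ ≤ ∑ m ∈ Finset.Icc 2 N, ∑ n ∈ Finset.Icc 2 N, (D m n + E m n + E n m) := by
        refine (norm_sum_le _ _).trans (Finset.sum_le_sum fun m hm => ?_)
        exact (norm_sum_le _ _).trans (Finset.sum_le_sum fun n hn => key m hm n hn)
    _ = ∑ m ∈ Finset.Icc 2 N, ∑ n ∈ Finset.Icc 2 N, D m n + ∑ n ∈ Finset.Icc 2 N, ∑ m ∈ Finset.Icc 2 N, E m n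
          + ∑ n ∈ Finset.Icc 2 N, ∑ m ∈ Finset.Icc 2 N, E m n := by
        simp only [Finset.sum_add_distrib]
        rw [Finset.sum_comm (f := fun m n => E m n)]
    _ ≤ _ := by
        have : ∑ m ∈ Finset.Icc 2 N, ∑ n ∈ Finset.Icc 2 N, D m n = (B - A) * ∑ n ∈ Finset.Icc 2 N, ‖a n‖ ^ 2 * (n:ℝ) ^ (-(2 * σ)) := by
          rw [Finset.mul_sum]
          refine Finset.sum_congr rfl fun m hm => ?_
          simp only [hD]
          rw [Finset.sum_ite_eq, if_pos hm]
        rw [this]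
        linarith

/-- The remainder in the partial sums beyond `N`. -/
noncomputable def remB (a : ℕ → ℂ) (κ : ℂ) (N : ℕ) : ℝ → ℂ :=
  (Set.Ioi (N:ℝ)).indicator fun u => ∑ k ∈ Finset.Icc 1 ⌊u⌋₊, a k - ∑ k ∈ Finset.Icc 1 N, a k - κ * (u - N)

lemma remB_meas (a : ℕ → ℂ) (κ : ℂ) (N : ℕ) : Measurable (remB a κ N) := by
  refine Measurable.indicator ?_ measurableSet_Ioi
  have h : Measurable (fun u : ℝ => ∑ k ∈ Finset.Icc 1 ⌊u⌋₊, a k) :=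
    (measurable_from_nat (f := fun n => ∑ k ∈ Finset.Icc 1 n, a k)).comp Nat.measurable_floor
  have h2 : Measurable (fun u : ℝ => κ * ((u:ℂ) - N)) := by fun_prop
  exact (h.sub_const _).sub h2

lemma remB_bound (a : ℕ → ℂ) (κ : ℂ) (N : ℕ) (C : ℝ)
    (h : ∀ u : ℝ, 0 ≤ u → ‖∑ k ∈ Finset.Icc 1 ⌊u⌋₊, a k - κ * u‖ ≤ C) (u : ℝ) :
    ‖remB a κ N u‖ ≤ 2 * C := by
  have hC : 0 ≤ C := (norm_nonneg _).trans (h 0 le_rfl)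
  by_cases hu : u ∈ Set.Ioi (N:ℝ)
  · rw [remB, Set.indicator_of_mem hu]
    have hu0 : (0:ℝ) ≤ u := (Nat.cast_nonneg N).trans (le_of_lt hu)
    have h1 := h u hu0
    have h2 := h N (Nat.cast_nonneg N)
    rw [Nat.floor_natCast] at h2
    have e : ∑ k ∈ Finset.Icc 1 ⌊u⌋₊, a k - ∑ k ∈ Finset.Icc 1 N, a k - κ * (u - N) =
      (∑ k ∈ Finset.Icc 1 ⌊u⌋₊, a k - κ * u) - (∑ k ∈ Finset.Icc 1 N, a k - κ * ((N:ℝ):ℂ)) := by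
      push_cast; ring
    rw [e]
    refine (norm_sub_le _ _).trans ?_
    linarith
  · rw [remB, Set.indicator_of_notMem hu]; simp; linarith

lemma remB_zero (a : ℕ → ℂ) (κ : ℂ) (N : ℕ) (u : ℝ) (hu : u ≤ N) : remB a κ N u = 0 :=
  Set.indicator_of_notMem (by simpa using hu) _

lemma remB_loc (a : ℕ → ℂ) (κ : ℂ) (N : ℕ) (C : ℝ)
    (h : ∀ u : ℝ, 0 ≤ u → ‖∑ k ∈ Finset.Icc 1 ⌊u⌋₊, a k - κ * u‖ ≤ C) :
    LocallyIntegrable (remB a κ N) := by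
  have hc : LocallyIntegrable (fun _ : ℝ => 2 * C) := locallyIntegrable_const _
  refine hc.mono (remB_meas a κ N).aestronglyMeasurable (Filter.Eventually.of_forall fun u => ?_)
  exact (remB_bound a κ N C h u).trans (le_abs_self _)

lemma remB_mellin_conv (a : ℕ → ℂ) (κ : ℂ) (N : ℕ) (hN : 1 ≤ N) (C : ℝ)
    (h : ∀ u : ℝ, 0 ≤ u → ‖∑ k ∈ Finset.Icc 1 ⌊u⌋₊, a k - κ * u‖ ≤ C) :
    ((remB a κ N) =O[Filter.atTop] fun x : ℝ => x ^ (-(0:ℝ))) ∧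
    ∀ b : ℝ, ((remB a κ N) =O[nhdsWithin 0 (Set.Ioi 0)] fun x : ℝ => x ^ (-b)) := by
  constructor
  · refine Asymptotics.IsBigO.of_bound (2 * C) (Filter.Eventually.of_forall fun u => ?_)
    simpa using remB_bound a κ N C h u
  · intro b
    refine Asymptotics.IsBigO.of_bound 1 ?_
    have : Set.Iio (1:ℝ) ∈ nhdsWithin (0:ℝ) (Set.Ioi 0) :=
      nhdsWithin_le_nhds (Iio_mem_nhds one_pos)
    filter_upwards [this] with u hu
    have hN' : (1:ℝ) ≤ N := by exact_mod_cast hN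
    rw [remB_zero a κ N u (by linarith [Set.mem_Iio.mp hu])]
    simp

lemma repr_gt_one (M : ℕ) [NeZero M] (ψ : DirichletCharacter ℂ M) (κ : ℂ) (C : ℝ)
    (h : ∀ u : ℝ, 0 ≤ u → ‖∑ k ∈ Finset.Icc 1 ⌊u⌋₊, ψ (k : ZMod M) - κ * u‖ ≤ C)
    (N : ℕ) (hN : 1 ≤ N) (s : ℂ) (hs : 1 < s.re) :
    DirichletCharacter.LFunction ψ s = ∑ n ∈ Finset.Icc 1 N, ψ (n : ZMod M) * (n:ℂ) ^ (-s) +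
      κ * (N:ℂ) ^ (1 - s) / (s - 1) + s * mellin (remB (fun k => ψ (k : ZMod M)) κ N) (-s) := by
  have hs0 : s ≠ 0 := by rintro rfl; simp at hs; linarith
  have hs1 : s - 1 ≠ 0 := by
    intro h0; have : s = 1 := by linear_combination h0
    rw [this] at hs; simp at hs
  have hN0 : (0:ℝ) < N := by exact_mod_cast hN
  set a : ℕ → ℂ := fun k => ψ (k : ZMod M) with ha
  set g : ℕ → ℂ := fun k => if k ≤ N then a k else 0 with hg
  set f : ℕ → ℂ := fun k => if k ≤ N then 0 else a k with hf
  have ha1 : ∀ k, ‖a k‖ ≤ 1 := fun k => DirichletCharacter.norm_le_one ψ _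
  have hgs : LSeriesSummable g s := LSeriesSummable_of_bounded_of_one_lt_re (m := 1) (fun n _ => by
    simp only [hg]; split_ifs; exacts [ha1 n, by simp]) hs
  have hfs : LSeriesSummable f s := LSeriesSummable_of_bounded_of_one_lt_re (m := 1) (fun n _ => by
    simp only [hf]; split_ifs; exacts [by simp, ha1 n]) hs
  have hgf : a = g + f := by
    ext k; simp only [hg, hf, Pi.add_apply]; split_ifs <;> simp
  rw [DirichletCharacter.LFunction_eq_LSeries ψ hs]
  change LSeries a s = _
  rw [hgf, LSeries_add hgs hfs, ← hgf]
  have e1 : LSeries g s = ∑ n ∈ Finset.Icc 1 N, a n * (n:ℂ) ^ (-s) := by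
    rw [LSeries, tsum_eq_sum (s := Finset.Icc 1 N)]
    · refine Finset.sum_congr rfl fun n hn => ?_
      rw [Finset.mem_Icc] at hn
      rw [LSeries.term_of_ne_zero (by omega), hg]
      simp only [hn.2, if_true]
      rw [Complex.cpow_neg]; rfl
    · intro n hn
      rw [Finset.mem_Icc] at hn
      by_cases h0 : n = 0
      · subst h0; simp
      · rw [LSeries.term_of_ne_zero h0, hg]
        simp only
        rw [if_neg (by omega), zero_div]
  have hsumf : ∀ t : ℝ, ∑ k ∈ Finset.Icc 1 ⌊t⌋₊, f k = remB a κ N t + (Set.Ioi (N:ℝ)).indicator (fun t : ℝ => κ * ((t:ℂ) - N)) t := by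
    intro t
    by_cases ht : t ∈ Set.Ioi (N:ℝ)
    · rw [remB, Set.indicator_of_mem ht, Set.indicator_of_mem ht]
      have hle : N ≤ ⌊t⌋₊ := Nat.le_floor (le_of_lt ht)
      have : ∑ k ∈ Finset.Icc 1 ⌊t⌋₊, a k = ∑ k ∈ Finset.Icc 1 N, a k + ∑ k ∈ Finset.Icc 1 ⌊t⌋₊, f k := by
        have hs : ∑ k ∈ Finset.Icc 1 ⌊t⌋₊, a k = ∑ k ∈ Finset.Icc 1 ⌊t⌋₊, g k + ∑ k ∈ Finset.Icc 1 ⌊t⌋₊, f k := by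
          rw [hgf]; simp [Finset.sum_add_distrib]
        rw [hs]; congr 1
        simp only [hg]
        rw [← Finset.sum_filter]
        congr 1; ext k; simp only [Finset.mem_filter, Finset.mem_Icc]; omega
      rw [this]; ring
    · rw [remB, Set.indicator_of_notMem ht, Set.indicator_of_notMem ht, add_zero]
      refine Finset.sum_eq_zero fun k hk => ?_
      rw [Finset.mem_Icc] at hk
      have hle : ⌊t⌋₊ ≤ N := Nat.floor_le_of_le (not_lt.mp ht)
      simp only [hf]
      rw [if_pos (by omega)]
  have hO : (fun n : ℕ => ∑ k ∈ Finset.Icc 1 n, f k) =O[Filter.atTop] fun n : ℕ => (n:ℝ) ^ (1:ℝ) := by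
    refine Asymptotics.IsBigO.of_bound 1 (Filter.Eventually.of_forall fun n => ?_)
    refine (norm_sum_le _ _).trans ?_
    have : ∀ k ∈ Finset.Icc 1 n, ‖f k‖ ≤ 1 := fun k _ => by
      simp only [hf]; split_ifs; exacts [by simp, ha1 k]
    refine (Finset.sum_le_sum this).trans ?_
    simp
  have e2 := LSeries_eq_mul_integral f (r := 1) zero_le_one hs hfs hO
  -- the two integrals
  have hmc := remB_mellin_conv a κ N hN C h
  have hsre : (-s).re < 0 := by simp; linarith
  have hm : MellinConvergent (remB a κ N) (-s) :=
    mellinConvergent_of_isBigO_rpow ((remB_loc a κ N C h).locallyIntegrableOn _) hmc.1 (by simpa using hsre)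
      (hmc.2 ((-s).re - 1)) (by linarith)
  have hsub : Set.Ioi (1:ℝ) ⊆ Set.Ioi 0 := Set.Ioi_subset_Ioi zero_le_one
  have i1 : IntegrableOn (fun t : ℝ => remB a κ N t * (t:ℂ) ^ (-(s + 1))) (Set.Ioi 1) := by
    refine (hm.mono_set hsub).congr (Filter.Eventually.of_forall fun t => ?_)
    simp only [smul_eq_mul]
    rw [mul_comm]; congr 2; ring
  have m1 : ∫ t in Set.Ioi (1:ℝ), remB a κ N t * (t:ℂ) ^ (-(s + 1)) = mellin (remB a κ N) (-s) := by
    rw [mellin]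
    rw [← setIntegral_eq_of_subset_of_forall_sdiff_eq_zero measurableSet_Ioi hsub]
    · refine integral_congr_ae (Filter.Eventually.of_forall fun t => ?_)
      simp only [smul_eq_mul]
      rw [mul_comm]; congr 2; ring
    · intro t ht
      have : t ≤ 1 := not_lt.mp ht.2
      rw [remB_zero a κ N t (this.trans (by exact_mod_cast hN))]
      simp
  have c1 : (-(s:ℂ)).re < -1 := by simp; linarith
  have c2 : (-(s + 1 : ℂ)).re < -1 := by simp; linarith
  have hsubN : Set.Ioi (N:ℝ) ⊆ Set.Ioi 1 := Set.Ioi_subset_Ioi (by exact_mod_cast hN)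
  have eqN : Set.EqOn (fun t : ℝ => κ * ((t:ℂ) - N) * (t:ℂ) ^ (-(s + 1)))
      (fun t : ℝ => κ * (t:ℂ) ^ (-s) - κ * N * (t:ℂ) ^ (-(s+1))) (Set.Ioi (N:ℝ)) := by
    intro t ht
    have ht0 : (t:ℂ) ≠ 0 := by
      have : 0 < t := hN0.trans ht
      exact_mod_cast this.ne'
    have : (t:ℂ) ^ (-s) = (t:ℂ) ^ (-(s+1)) * t := by
      rw [show -s = -(s+1) + 1 by ring, Complex.cpow_add _ _ ht0, Complex.cpow_one]
    simp only [this]; ring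
  have j1 := (integrableOn_Ioi_cpow_of_lt c1 hN0).const_mul κ
  have j2 := (integrableOn_Ioi_cpow_of_lt c2 hN0).const_mul (κ * N)
  have i2' : IntegrableOn (fun t : ℝ => κ * ((t:ℂ) - N) * (t:ℂ) ^ (-(s + 1))) (Set.Ioi (N:ℝ)) :=
    IntegrableOn.congr_fun (j1.sub j2) eqN.symm measurableSet_Ioi
  have ind : (fun t : ℝ => (Set.Ioi (N:ℝ)).indicator (fun t : ℝ => κ * ((t:ℂ) - N)) t * (t:ℂ) ^ (-(s + 1))) =
     (Set.Ioi (N:ℝ)).indicator (fun t : ℝ => κ * ((t:ℂ) - N) * (t:ℂ) ^ (-(s + 1))) := by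
    ext t; by_cases ht : t ∈ Set.Ioi (N:ℝ)
    · simp only [Set.indicator_of_mem ht]
    · simp only [Set.indicator_of_notMem ht, zero_mul]
  have i2 : IntegrableOn (fun t : ℝ => (Set.Ioi (N:ℝ)).indicator (fun t : ℝ => κ * ((t:ℂ) - N)) t * (t:ℂ) ^ (-(s + 1))) (Set.Ioi 1) := by
    rw [ind]
    exact (i2'.integrable_indicator measurableSet_Ioi).integrableOn
  have m2 : ∫ t in Set.Ioi (1:ℝ), (Set.Ioi (N:ℝ)).indicator (fun t : ℝ => κ * ((t:ℂ) - N)) t * (t:ℂ) ^ (-(s + 1)) =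
      κ * (N:ℂ) ^ (1 - s) / (s - 1) / s := by
    rw [ind, setIntegral_indicator measurableSet_Ioi, Set.inter_eq_self_of_subset_right hsubN,
      setIntegral_congr_fun measurableSet_Ioi eqN, integral_sub j1 j2, integral_const_mul, integral_const_mul,
      integral_Ioi_cpow_of_lt c1 hN0, integral_Ioi_cpow_of_lt c2 hN0]
    have hNc : ((N:ℝ):ℂ) ≠ 0 := by exact_mod_cast hN0.ne'
    have p1 : ((N:ℝ):ℂ) ^ (-s + 1) = (N:ℂ) ^ (1 - s) := by push_cast; congr 1; ring
    have p2 : (N:ℂ) * ((N:ℝ):ℂ) ^ (-(s + 1) + 1) = (N:ℂ) ^ (1 - s) := by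
      rw [← p1, show -(s+1)+1 = -s by ring, Complex.cpow_add (-s) 1 hNc, Complex.cpow_one]; push_cast
      ring
    have q1 : -s + 1 ≠ 0 := fun h0 => hs1 (by linear_combination -h0)
    have q2 : -(s+1) + 1 ≠ 0 := fun h0 => hs0 (by linear_combination -h0)
    rw [p1]
    have : κ * (N:ℂ) * (-((N:ℝ):ℂ) ^ (-(s + 1) + 1) / (-(s+1)+1)) = κ * (N:ℂ) ^ (1 - s) / s := by
      rw [← p2]
      rw [show -(s+1)+1 = -s by ring] at *
      field_simp
    rw [this]
    have : -(N:ℂ) ^ (1 - s) / (-s + 1) = (N:ℂ) ^ (1 - s) / (s - 1) := by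
      rw [show -s + 1 = -(s - 1) by ring, neg_div_neg_eq]
    rw [this]
    field_simp
    ring
  rw [e1, e2]
  simp_rw [hsumf, add_mul]
  rw [integral_add i1 i2, m1, m2]
  field_simp
  ring

lemma repr_LF (M : ℕ) [NeZero M] (ψ : DirichletCharacter ℂ M) (κ : ℂ) (C : ℝ)
    (h : ∀ u : ℝ, 0 ≤ u → ‖∑ k ∈ Finset.Icc 1 ⌊u⌋₊, ψ (k : ZMod M) - κ * u‖ ≤ C)
    (N : ℕ) (hN : 1 ≤ N) (s : ℂ) (hs : 0 < s.re) (hs' : 0 < s.im) :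
    DirichletCharacter.LFunction ψ s = ∑ n ∈ Finset.Icc 1 N, ψ (n : ZMod M) * (n:ℂ) ^ (-s) +
      κ * (N:ℂ) ^ (1 - s) / (s - 1) + s * mellin (remB (fun k => ψ (k : ZMod M)) κ N) (-s) := by
  set U : Set ℂ := {z | 0 < z.re} ∩ {z | 0 < z.im} with hU
  have hUo : IsOpen U := (isOpen_lt continuous_const Complex.continuous_re).inter
    (isOpen_lt continuous_const Complex.continuous_im)
  have hUc : Convex ℝ U := (convex_halfSpace_re_gt 0).inter (convex_halfSpace_im_gt 0)
  have hne : ∀ z ∈ U, z ≠ 1 := by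
    rintro z hz rfl
    simp [hU] at hz
  have hNc : (N:ℂ) ≠ 0 := by exact_mod_cast (by omega : N ≠ 0)
  have hf : AnalyticOnNhd ℂ (DirichletCharacter.LFunction ψ) U :=
    DifferentiableOn.analyticOnNhd (fun z hz =>
      (DirichletCharacter.differentiableAt_LFunction ψ z (Or.inl (hne z hz))).differentiableWithinAt) hUo
  have hg : AnalyticOnNhd ℂ (fun s => ∑ n ∈ Finset.Icc 1 N, ψ (n : ZMod M) * (n:ℂ) ^ (-s) +
      κ * (N:ℂ) ^ (1 - s) / (s - 1) + s * mellin (remB (fun k => ψ (k : ZMod M)) κ N) (-s)) U := by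
    refine DifferentiableOn.analyticOnNhd (fun z hz => DifferentiableAt.differentiableWithinAt ?_) hUo
    refine ((DifferentiableAt.fun_sum fun n hn => ?_).add ?_).add ?_
    · rw [Finset.mem_Icc] at hn
      have : (n:ℂ) ≠ 0 := by exact_mod_cast (by omega : n ≠ 0)
      exact (differentiableAt_id.neg.const_cpow (Or.inl this)).const_mul _
    · refine DifferentiableAt.div ?_ (by fun_prop) (sub_ne_zero.mpr (hne z hz))
      exact (((differentiableAt_const 1).sub differentiableAt_id).const_cpow (Or.inl hNc)).const_mul _
    · refine differentiableAt_id.mul ?_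
      have hmc := remB_mellin_conv (fun k => ψ (k : ZMod M)) κ N hN C h
      have hzre : (-z).re < 0 := by have := hz.1; simp at this ⊢; linarith
      have := mellin_differentiableAt_of_isBigO_rpow (s := -z) ((remB_loc _ κ N C h).locallyIntegrableOn _) hmc.1 hzre
        (hmc.2 ((-z).re - 1)) (by linarith)
      exact DifferentiableAt.comp (g := mellin (remB (fun k => ψ (k : ZMod M)) κ N)) z this differentiableAt_id.neg
  refine hf.eqOn_of_preconnected_of_eventuallyEq hg hUc.isPreconnected (z₀ := 2 + Complex.I) ?_ ?_ ⟨hs, hs'⟩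
  · simp [hU]
  · have : {z : ℂ | 1 < z.re} ∈ nhds (2 + Complex.I) :=
      (isOpen_lt continuous_const Complex.continuous_re).mem_nhds (by simp)
    filter_upwards [this] with z hz
    exact repr_gt_one M ψ κ C h N hN z hz

lemma sum_tail (b : ℝ) (hb : 0 < b) (K N : ℕ) (hK : 1 ≤ K) :
    ∑ n ∈ Finset.Ioc K N, (n:ℝ) ^ (-1 - b) ≤ (K:ℝ) ^ (-b) / b := by
  by_cases hKN : K ≤ N
  · have key : ∀ N, K ≤ N → ∑ n ∈ Finset.Ioc K N, (n:ℝ) ^ (-1 - b) ≤ ((K:ℝ) ^ (-b) - (N:ℝ) ^ (-b)) / b := by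
      intro N hN
      induction N, hN using Nat.le_induction with
      | base => simp
      | succ m hm ih =>
        rw [← Finset.insert_Ioc_right_eq_Ioc_add_one hm, Finset.sum_insert (by simp)]
        have hm0 : (0:ℝ) < m := by exact_mod_cast (by omega : 0 < m)
        have hM0 : (0:ℝ) < ((m+1:ℕ):ℝ) := by positivity
        set M : ℝ := ((m+1:ℕ):ℝ) with hM
        have hMm : M = m + 1 := by rw [hM]; push_cast; rfl
        have h1 : M ^ (-b) * (1 + b / M) ≤ (m:ℝ) ^ (-b) := by
          have e : (m:ℝ) ^ (-b) = M ^ (-b) * (m / M) ^ (-b) := by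
            rw [← Real.mul_rpow hM0.le (by positivity)]; congr 1; field_simp
          rw [e]
          gcongr
          rw [Real.rpow_def_of_pos (by positivity)]
          have h2 := Real.log_le_sub_one_of_pos (div_pos hm0 hM0)
          have h3 : (m:ℝ) / M - 1 = - (1 / M) := by rw [hMm]; field_simp; ring
          have h4 := Real.add_one_le_exp (Real.log (m / M) * -b)
          have h5 : b / M = b * (1 / M) := by ring
          rw [h5]
          nlinarith
        have h2 : M ^ (-1 - b) = M ^ (-b) / M := by
          rw [show -1 - b = -b - 1 by ring, Real.rpow_sub_one hM0.ne']
        rw [h2]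
        have h3 : M ^ (-b) / M ≤ ((m:ℝ) ^ (-b) - M ^ (-b)) / b := by
          rw [le_div_iff₀ hb]
          have : M ^ (-b) * (1 + b / M) = M ^ (-b) + M ^ (-b) / M * b := by ring
          linarith
        have h4 : ((K:ℝ) ^ (-b) - M ^ (-b)) / b = ((K:ℝ) ^ (-b) - (m:ℝ) ^ (-b)) / b + ((m:ℝ) ^ (-b) - M ^ (-b)) / b := by ring
        rw [h4]; linarith
    refine (key N hKN).trans ?_
    gcongr
    have : (0:ℝ) ≤ (N:ℝ) ^ (-b) := by positivity
    linarith
  · rw [Finset.Ioc_eq_empty (by omega), Finset.sum_empty]; positivity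

lemma sum_small (a : ℝ) (ha : 0 < a) (ha1 : a ≤ 1) (N : ℕ) :
    ∑ n ∈ Finset.Icc 2 N, (n:ℝ) ^ (a - 1) ≤ (N:ℝ) ^ a / a := by
  induction N with
  | zero => simp [ha.ne']
  | succ m ih =>
    by_cases hm : m = 0
    · subst hm; simp; positivity
    rw [← Finset.insert_Icc_right_eq_Icc_add_one (by omega), Finset.sum_insert (by simp)]
    have hm0 : (0:ℝ) < m := by exact_mod_cast (by omega : 0 < m)
    have hM0 : (0:ℝ) < ((m+1:ℕ):ℝ) := by positivity
    set M : ℝ := ((m+1:ℕ):ℝ) with hM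
    have hMm : M = m + 1 := by rw [hM]; push_cast; rfl
    have hM1 : 1 ≤ M := by linarith
    have h1 : (m:ℝ) ^ a ≤ M ^ a * (1 - a / M) := by
      have e : (m:ℝ) ^ a = M ^ a * (1 + -(1 / M)) ^ a := by
        have : (0:ℝ) ≤ 1 + -(1/M) := by
          have : 1 / M ≤ 1 := by rw [div_le_one hM0]; exact hM1
          linarith
        rw [← Real.mul_rpow hM0.le this]; congr 1; rw [hMm]; field_simp; ring
      rw [e]
      have h2 := rpow_one_add_le_one_add_mul_self (s := -(1/M)) (p := a) (by
          have : 1 / M ≤ 1 := by rw [div_le_one hM0]; exact hM1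
          linarith) ha.le ha1
      have h3 : 1 - a / M = 1 + a * -(1/M) := by ring
      rw [h3]
      gcongr
    have h2 : M ^ (a - 1) = M ^ a / M := Real.rpow_sub_one hM0.ne' _
    rw [h2]
    have h3 : M ^ a / M ≤ (M ^ a - (m:ℝ) ^ a) / a := by
      rw [le_div_iff₀ ha]
      have : M ^ a * (1 - a / M) = M ^ a - M ^ a / M * a := by ring
      linarith
    have h4 : M ^ a / a = (m:ℝ) ^ a / a + (M ^ a - (m:ℝ) ^ a) / a := by ring
    rw [h4]; linarith

lemma tail_mean (a : ℕ → ℂ) (κ : ℂ) (N : ℕ) (hN : 1 ≤ N) (C : ℝ)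
    (h : ∀ u : ℝ, 0 ≤ u → ‖∑ k ∈ Finset.Icc 1 ⌊u⌋₊, a k - κ * u‖ ≤ C) (σ : ℝ) (hσ : 0 < σ)
    (Y : ℝ) (hY : 0 < Y) :
    ∫ t in Set.Icc (-Y) Y, ‖mellin (remB a κ N) (-((σ:ℂ) + t * Complex.I))‖ ^ 2 ≤
      24 * Real.pi * C ^ 2 * ((N:ℝ) ^ (-(2 * σ)) / (2 * σ)) := by
  have hN0 : (0:ℝ) < N := by exact_mod_cast hN
  have hC : 0 ≤ C := (norm_nonneg _).trans (h 0 le_rfl)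
  set g : ℝ → ℂ := fun u => Real.exp (σ * u) • remB a κ N (Real.exp (-u)) with hg
  have hgm : Measurable g := by
    have h1 : Measurable (fun u : ℝ => Real.exp (σ * u)) := by fun_prop
    have h2 : Measurable (fun u : ℝ => remB a κ N (Real.exp (-u))) :=
      (remB_meas a κ N).comp (by fun_prop)
    exact h1.smul h2
  set c : ℝ := -Real.log N with hc
  have hgb : ∀ u, ‖g u‖ ≤ (Set.Iic c).indicator (fun u => 2 * C * Real.exp (σ * u)) u := by
    intro u
    by_cases hu : u ∈ Set.Iic c
    · rw [Set.indicator_of_mem hu, hg]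
      simp only [norm_smul, Real.norm_of_nonneg (Real.exp_pos _).le]
      rw [mul_comm]
      gcongr
      exact remB_bound a κ N C h _
    · rw [Set.indicator_of_notMem hu, hg]
      have : Real.exp (-u) ≤ N := by
        have hu' : c < u := not_le.mp hu
        rw [← Real.exp_log hN0]
        apply Real.exp_le_exp.mpr; simp only [hc] at hu'; linarith
      simp [remB_zero a κ N _ this]
  have hgb2 : ∀ u, ‖g u‖ ^ 2 ≤ (Set.Iic c).indicator (fun u => 4 * C ^ 2 * Real.exp (2 * σ * u)) u := by
    intro u
    have := hgb u
    by_cases hu : u ∈ Set.Iic c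
    · rw [Set.indicator_of_mem hu] at this ⊢
      calc _ ≤ (2 * C * Real.exp (σ * u)) ^ 2 := by gcongr
        _ = _ := by rw [mul_pow, ← Real.exp_nat_mul]; push_cast; ring_nf
    · rw [Set.indicator_of_notMem hu] at this ⊢
      have : ‖g u‖ = 0 := le_antisymm this (norm_nonneg _)
      rw [this]; norm_num
  have i1 : Integrable ((Set.Iic c).indicator (fun u => 2 * C * Real.exp (σ * u))) :=
    IntegrableOn.integrable_indicator ((integrableOn_exp_mul_Iic hσ c).const_mul _) measurableSet_Iic
  have i2 : Integrable ((Set.Iic c).indicator (fun u => 4 * C ^ 2 * Real.exp (2 * σ * u))) :=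
    IntegrableOn.integrable_indicator ((integrableOn_exp_mul_Iic (by positivity : 0 < 2 * σ) c).const_mul _) measurableSet_Iic
  have hgi : Integrable g := i1.mono' hgm.aestronglyMeasurable (Filter.Eventually.of_forall hgb)
  have hgi2 : Integrable (fun u => ‖g u‖ ^ 2) :=
    i2.mono' (hgm.norm.pow_const 2).aestronglyMeasurable (Filter.Eventually.of_forall fun u => by
      rw [norm_pow, norm_norm]; exact hgb2 u)
  have hL2 : ∫ u, ‖g u‖ ^ 2 ≤ 4 * C ^ 2 * ((N:ℝ) ^ (-(2 * σ)) / (2 * σ)) := by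
    refine (integral_mono hgi2 i2 hgb2).trans ?_
    rw [integral_indicator measurableSet_Iic, integral_const_mul, integral_exp_mul_Iic (by positivity)]
    rw [Real.rpow_def_of_pos hN0, hc]
    apply le_of_eq; congr 3; ring_nf
  have hpl := plancherel_le g hgi hgi2 (Y / (2 * Real.pi)) (by positivity)
  have e1 : ∀ t : ℝ, mellin (remB a κ N) (-((σ:ℂ) + t * Complex.I)) = 𝓕 g (-(t / (2 * Real.pi))) := by
    intro t
    rw [mellin_eq_fourier]
    have r1 : (-((σ:ℂ) + t * Complex.I)).re = -σ := by simp
    have r2 : (-((σ:ℂ) + t * Complex.I)).im = -t := by simp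
    rw [r1, r2, neg_neg, neg_div]
  simp_rw [e1]
  have e2 : ∫ t in Set.Icc (-Y) Y, ‖𝓕 g (-(t / (2 * Real.pi)))‖ ^ 2 =
      2 * Real.pi * ∫ ξ in Set.Icc (-(Y / (2 * Real.pi))) (Y / (2 * Real.pi)), ‖𝓕 g ξ‖ ^ 2 := by
    have hp : (0:ℝ) < Y / (2 * Real.pi) := by positivity
    rw [integral_Icc_eq_integral_Ioc, integral_Icc_eq_integral_Ioc, ← intervalIntegral.integral_of_le (by linarith),
      ← intervalIntegral.integral_of_le (by linarith)]
    rw [intervalIntegral.integral_comp_div (fun x => ‖𝓕 g (-x)‖ ^ 2) (by positivity : 2 * Real.pi ≠ 0)]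
    rw [intervalIntegral.integral_comp_neg (fun x => ‖𝓕 g x‖ ^ 2)]
    simp only [smul_eq_mul, neg_div, neg_neg]
  rw [e2]
  have hpi := Real.pi_pos
  calc _ ≤ 2 * Real.pi * (3 * (4 * C ^ 2 * ((N:ℝ) ^ (-(2 * σ)) / (2 * σ)))) := by
        gcongr
        exact hpl.trans (by gcongr)
    _ = _ := by ring

lemma three_sq (x y z : ℂ) : ‖x + y + z‖ ^ 2 ≤ 3 * ‖x‖ ^ 2 + 3 * ‖y‖ ^ 2 + 3 * ‖z‖ ^ 2 := by
  have h := (norm_add_le (x + y) z).trans (add_le_add_left (norm_add_le x y) ‖z‖)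
  have h2 : ‖x + y + z‖ ^ 2 ≤ (‖x‖ + ‖y‖ + ‖z‖) ^ 2 := by gcongr
  nlinarith [sq_nonneg (‖x‖ - ‖y‖), sq_nonneg (‖x‖ - ‖z‖), sq_nonneg (‖y‖ - ‖z‖)]

lemma mean_sq (M : ℕ) [NeZero M] (ψ : DirichletCharacter ℂ M) (κ : ℂ) (C : ℝ) (hC1 : 1 ≤ C)
    (h : ∀ u : ℝ, 0 ≤ u → ‖∑ k ∈ Finset.Icc 1 ⌊u⌋₊, ψ (k : ZMod M) - κ * u‖ ≤ C)
    (K : ℕ) (hK : 1 ≤ K) (h0 : ∀ n : ℕ, 1 < n → n ≤ K → ψ (n : ZMod M) = 0)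
    (σ ω : ℝ) (hω : 0 < ω) (hω4 : ω < 1 / 4) (hσ : 1 / 2 + ω ≤ σ) (hσ1 : σ ≤ 1) (T : ℝ) (hT : 4 ≤ T) :
    ∫ t in Set.Icc (T / 4) (2 * T), ‖DirichletCharacter.LFunction ψ ((σ:ℂ) + t * Complex.I) - 1‖ ^ 2 ≤
      3 * T * (K:ℝ) ^ (-(2 * ω)) / ω + (48 * (1 + Real.log T) + 10000 * C ^ 2) * T ^ (1 - 2 * ω) := by
  have hT0 : 0 < T := by linarith
  set N := ⌊T⌋₊ with hNdef
  have hNT : (N:ℝ) ≤ T := Nat.floor_le hT0.le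
  have hTN : T / 2 ≤ N := by have := Nat.lt_floor_add_one T; rw [← hNdef] at this; linarith
  have hN0 : (0:ℝ) < N := by linarith
  have hN : 1 ≤ N := by exact_mod_cast (show (0:ℝ) < N from hN0)
  have hN1 : (1:ℝ) ≤ N := by exact_mod_cast hN
  have hNc : (N:ℂ) ≠ 0 := by exact_mod_cast hN0.ne'
  set a : ℕ → ℂ := fun k => ψ (k : ZMod M) with ha
  have ha1 : ∀ k, ‖a k‖ ≤ 1 := fun k => DirichletCharacter.norm_le_one ψ _
  have hσ0 : 0 < σ := by linarith
  set I := Set.Icc (T / 4) (2 * T) with hI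
  set s : ℝ → ℂ := fun t => (σ:ℂ) + t * Complex.I with hs
  have hsc : Continuous s := by rw [hs]; fun_prop
  have hsre : ∀ t, (s t).re = σ := fun t => by simp [hs]
  have hsim : ∀ t, (s t).im = t := fun t => by simp [hs]
  set P : ℝ → ℂ := fun t => ∑ n ∈ Finset.Icc 2 N, a n * (n:ℂ) ^ (-((σ:ℂ) + t * Complex.I)) with hP
  set R : ℝ → ℂ := fun t => κ * (N:ℂ) ^ (1 - s t) / (s t - 1) with hR
  set G : ℝ → ℂ := fun t => mellin (remB a κ N) (-((σ:ℂ) + t * Complex.I)) with hG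
  have hne : ∀ t ∈ I, s t - 1 ≠ 0 := by
    intro t ht h1
    have := congrArg Complex.im h1
    simp [hsim] at this
    have := ht.1
    linarith
  have hrep : ∀ t ∈ I, DirichletCharacter.LFunction ψ (s t) - 1 = P t + R t + s t * G t := by
    intro t ht
    have ht0 : 0 < t := by have := ht.1; linarith
    rw [repr_LF M ψ κ C h N hN (s t) (by rw [hsre]; exact hσ0) (by rw [hsim]; exact ht0)]
    rw [← Finset.add_sum_Ioc_eq_sum_Icc hN]
    have : Finset.Ioc 1 N = Finset.Icc 2 N := by ext; simp; omega
    rw [this]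
    simp only [hP, hR, hG, hs, ha, Nat.cast_one, map_one, Complex.one_cpow]
    ring
  have cP : Continuous P := by
    rw [hP]
    refine continuous_finsetSum _ fun n hn => ?_
    rw [Finset.mem_Icc] at hn
    have : (n:ℂ) ≠ 0 := by exact_mod_cast (by omega : n ≠ 0)
    exact continuous_const.mul (Continuous.const_cpow (by fun_prop) (Or.inl this))
  have cR : ContinuousOn R I := by
    rw [hR]
    refine ContinuousOn.div ?_ (by fun_prop) hne
    exact (continuous_const.mul (Continuous.const_cpow (by fun_prop) (Or.inl hNc))).continuousOn
  have cG : Continuous G := by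
    rw [continuous_iff_continuousAt]
    intro t
    have hmc := remB_mellin_conv a κ N hN C h
    have hzre : (-(s t)).re < 0 := by rw [Complex.neg_re, hsre]; linarith
    have := mellin_differentiableAt_of_isBigO_rpow (s := -(s t)) ((remB_loc _ κ N C h).locallyIntegrableOn _) hmc.1 hzre
        (hmc.2 ((-(s t)).re - 1)) (by linarith)
    exact ContinuousAt.comp (g := mellin (remB a κ N)) (f := fun t => -(s t)) this.continuousAt hsc.neg.continuousAt
  have hIm : MeasurableSet I := measurableSet_Icc
  have hIc : IsCompact I := isCompact_Icc
  have iP : IntegrableOn (fun t => 3 * ‖P t‖ ^ 2) I := by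
    apply ContinuousOn.integrableOn_compact hIc; fun_prop
  have iR : IntegrableOn (fun t => 3 * ‖R t‖ ^ 2) I := by
    apply ContinuousOn.integrableOn_compact hIc; exact continuousOn_const.mul (cR.norm.pow 2)
  have iG : IntegrableOn (fun t => 3 * ‖s t * G t‖ ^ 2) I := by
    apply ContinuousOn.integrableOn_compact hIc; fun_prop
  have iPR : IntegrableOn (fun t => 3 * ‖P t‖ ^ 2 + 3 * ‖R t‖ ^ 2) I := iP.add iR
  have step1 : ∫ t in I, ‖DirichletCharacter.LFunction ψ (s t) - 1‖ ^ 2 ≤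
      3 * (∫ t in I, ‖P t‖ ^ 2) + 3 * (∫ t in I, ‖R t‖ ^ 2) + 3 * (∫ t in I, ‖s t * G t‖ ^ 2) := by
    rw [← integral_const_mul, ← integral_const_mul, ← integral_const_mul, ← integral_add iP iR,
      ← integral_add iPR iG]
    rw [setIntegral_congr_fun hIm (g := fun t => ‖P t + R t + s t * G t‖ ^ 2) (fun t ht => by
      simp only [hrep t ht])]
    refine setIntegral_mono_on ?_ (iPR.add iG) hIm (fun t _ => three_sq _ _ _)
    apply ContinuousOn.integrableOn_compact hIc
    exact (((cP.continuousOn.add cR).add (hsc.mul cG).continuousOn).norm.pow 2)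
  refine step1.trans ?_
  have hvol : volume.real I = 7 / 4 * T := by
    rw [hI, measureReal_def, Real.volume_Icc, ENNReal.toReal_ofReal (by linarith)]; ring
  have hTp : 0 < T ^ (1 - 2 * ω) := by positivity
  -- poly
  have bP : ∫ t in I, ‖P t‖ ^ 2 ≤ T * (K:ℝ) ^ (-(2 * ω)) / ω + 16 * (1 + Real.log T) * T ^ (1 - 2 * ω) := by
    refine (poly_mean N a ha1 σ hσ1 (T / 4) (2 * T) (by linarith)).trans ?_
    have s1 : ∑ n ∈ Finset.Icc 2 N, ‖a n‖ ^ 2 * (n:ℝ) ^ (-(2 * σ)) ≤ (K:ℝ) ^ (-(2 * ω)) / (2 * ω) := by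
      calc _ ≤ ∑ n ∈ Finset.Icc 2 N, (if K < n then (n:ℝ) ^ (-1 - 2 * ω) else 0) := by
            refine Finset.sum_le_sum fun n hn => ?_
            rw [Finset.mem_Icc] at hn
            have hn1 : (1:ℝ) ≤ n := by exact_mod_cast (by omega : 1 ≤ n)
            split_ifs with hK'
            · have e1 : ‖a n‖ ^ 2 ≤ 1 := pow_le_one₀ (norm_nonneg _) (ha1 n)
              have e2 : (n:ℝ) ^ (-(2 * σ)) ≤ (n:ℝ) ^ (-1 - 2 * ω) :=
                Real.rpow_le_rpow_of_exponent_le hn1 (by linarith)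
              calc _ ≤ 1 * (n:ℝ) ^ (-1 - 2 * ω) := by gcongr
                _ = _ := one_mul _
            · have : a n = 0 := h0 n (by omega) (by omega)
              rw [this]; simp
        _ = ∑ n ∈ (Finset.Icc 2 N).filter (K < ·), (n:ℝ) ^ (-1 - 2 * ω) := by rw [Finset.sum_filter]
        _ ≤ ∑ n ∈ Finset.Ioc K N, (n:ℝ) ^ (-1 - 2 * ω) := by
            refine Finset.sum_le_sum_of_subset_of_nonneg (fun n hn => ?_) (fun n _ _ => by positivity)
            simp only [Finset.mem_filter, Finset.mem_Icc, Finset.mem_Ioc] at hn ⊢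
            omega
        _ ≤ _ := sum_tail (2 * ω) (by linarith) K N hK
    have s2 : ∑ n ∈ Finset.Icc 2 N, (n:ℝ) ^ (1 - 2 * σ) ≤ 2 * T ^ (1 - 2 * ω) := by
      calc _ ≤ ∑ n ∈ Finset.Icc 2 N, (n:ℝ) ^ ((1 - 2 * ω) - 1) := by
            refine Finset.sum_le_sum fun n hn => ?_
            rw [Finset.mem_Icc] at hn
            have hn1 : (1:ℝ) ≤ n := by exact_mod_cast (by omega : 1 ≤ n)
            exact Real.rpow_le_rpow_of_exponent_le hn1 (by linarith)
        _ ≤ (N:ℝ) ^ (1 - 2 * ω) / (1 - 2 * ω) := sum_small _ (by linarith) (by linarith) N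
        _ ≤ T ^ (1 - 2 * ω) / (1 / 2) := by
            gcongr <;> linarith
        _ = _ := by ring
    have hl : Real.log N ≤ Real.log T := Real.log_le_log hN0 hNT
    have hl0 : 0 ≤ Real.log N := Real.log_nonneg hN1
    calc _ ≤ (2 * T) * ((K:ℝ) ^ (-(2 * ω)) / (2 * ω)) + 8 * (1 + Real.log T) * (2 * T ^ (1 - 2 * ω)) := by
          gcongr
          · linarith
          · linarith
      _ = _ := by field_simp; ring
  -- pole
  have hκ : ‖κ‖ ≤ 2 * C := by
    have := h 1 zero_le_one
    have a1 : a 1 = 1 := by simp [ha]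
    simp [a1] at this
    have h2 : ‖κ‖ ≤ ‖(1:ℂ)‖ + ‖1 - κ‖ := by
      have := norm_sub_le (1:ℂ) (1 - κ); simpa using this
    simp at h2
    linarith
  have bR : ∫ t in I, ‖R t‖ ^ 2 ≤ 128 * C ^ 2 * T ^ (1 - 2 * ω) := by
    have hb : ∀ t ∈ I, ‖R t‖ ^ 2 ≤ 64 * C ^ 2 * T ^ (1 - 2 * ω) / T ^ 2 := by
      intro t ht
      have e1 : ‖(N:ℂ) ^ (1 - s t)‖ = (N:ℝ) ^ (1 - σ) := by
        rw [← Complex.ofReal_natCast, Complex.norm_cpow_eq_rpow_re_of_pos hN0]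
        simp [hsre]
      have e2 : T / 4 ≤ ‖s t - 1‖ := by
        have := Complex.abs_im_le_norm (s t - 1)
        simp [hsim] at this
        have h3 := ht.1
        linarith [le_abs_self t]
      have e3 : ((N:ℝ) ^ (1 - σ)) ^ 2 ≤ T ^ (1 - 2 * ω) := by
        rw [← Real.rpow_natCast, ← Real.rpow_mul hN0.le]
        calc _ ≤ T ^ ((1 - σ) * (2:ℕ)) := Real.rpow_le_rpow hN0.le hNT (by push_cast; linarith)
          _ ≤ _ := Real.rpow_le_rpow_of_exponent_le (by linarith) (by push_cast; linarith)
      rw [hR]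
      simp only [norm_div, norm_mul, e1]
      rw [div_pow, mul_pow]
      calc _ ≤ (2 * C) ^ 2 * T ^ (1 - 2 * ω) / (T / 4) ^ 2 := by gcongr
        _ = _ := by field_simp; ring
    calc _ ≤ ∫ t in I, 64 * C ^ 2 * T ^ (1 - 2 * ω) / T ^ 2 := by
          refine setIntegral_mono_on ?_ (by simp [hI]) hIm hb
          exact ContinuousOn.integrableOn_compact hIc (cR.norm.pow 2)
      _ = (7 / 4 * T) * (64 * C ^ 2 * T ^ (1 - 2 * ω) / T ^ 2) := by
          rw [setIntegral_const, hvol, smul_eq_mul]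
      _ = 112 * C ^ 2 * T ^ (1 - 2 * ω) * (1 / T) := by field_simp; ring
      _ ≤ 112 * C ^ 2 * T ^ (1 - 2 * ω) * 1 := by
          gcongr; rw [div_le_one hT0]; linarith
      _ ≤ _ := by nlinarith [mul_nonneg (sq_nonneg C) hTp.le]
  -- tail
  have bG : ∫ t in I, ‖s t * G t‖ ^ 2 ≤ 2000 * C ^ 2 * T ^ (1 - 2 * ω) := by
    have iG2 : IntegrableOn (fun t => ‖G t‖ ^ 2) (Set.Icc (-(2 * T)) (2 * T)) := by
      apply ContinuousOn.integrableOn_compact isCompact_Icc; fun_prop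
    have hsub : I ⊆ Set.Icc (-(2 * T)) (2 * T) := Set.Icc_subset_Icc (by linarith) le_rfl
    have hb : ∀ t ∈ I, ‖s t * G t‖ ^ 2 ≤ 5 * T ^ 2 * ‖G t‖ ^ 2 := by
      intro t ht
      rw [norm_mul, mul_pow]
      gcongr
      rw [Complex.sq_norm, Complex.normSq_apply, hsre, hsim]
      have := ht.1; have := ht.2
      nlinarith
    have e3 : (N:ℝ) ^ (-(2 * σ)) ≤ 4 * T ^ (1 - 2 * ω) / T ^ 2 := by
      calc _ ≤ (T / 2) ^ (-(2 * σ)) := Real.rpow_le_rpow_of_nonpos (by linarith) hTN (by linarith)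
        _ = T ^ (-(2 * σ)) * (2:ℝ) ^ (2 * σ) := by
            rw [Real.div_rpow hT0.le (by norm_num), Real.rpow_neg (by norm_num : (0:ℝ) ≤ 2)]; field_simp
        _ ≤ T ^ ((1 - 2 * ω) - (2:ℕ)) * (2:ℝ) ^ ((2:ℕ):ℝ) := by
            gcongr
            · linarith
            · push_cast; linarith
            · norm_num
            · push_cast; linarith
        _ = _ := by
            rw [Real.rpow_sub_natCast hT0.ne', Real.rpow_natCast]; ring
    calc _ ≤ ∫ t in I, 5 * T ^ 2 * ‖G t‖ ^ 2 := by
          refine setIntegral_mono_on ?_ ((iG2.mono_set hsub).const_mul _) hIm hb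
          apply ContinuousOn.integrableOn_compact hIc; fun_prop
      _ = 5 * T ^ 2 * ∫ t in I, ‖G t‖ ^ 2 := integral_const_mul _ _
      _ ≤ 5 * T ^ 2 * (24 * Real.pi * C ^ 2 * ((N:ℝ) ^ (-(2 * σ)) / (2 * σ))) := by
          gcongr
          refine le_trans ?_ (tail_mean a κ N hN C h σ hσ0 (2 * T) (by linarith))
          exact setIntegral_mono_set iG2 (Filter.Eventually.of_forall fun t => by positivity) hsub.eventuallyLE
      _ ≤ 5 * T ^ 2 * (24 * 3.15 * C ^ 2 * ((4 * T ^ (1 - 2 * ω) / T ^ 2) / 1)) := by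
          gcongr
          · exact Real.pi_lt_d2.le
          · linarith
      _ = 1512 * (C ^ 2 * T ^ (1 - 2 * ω)) := by field_simp; ring
      _ ≤ _ := by nlinarith [mul_nonneg (sq_nonneg C) hTp.le]
  have : 0 ≤ C ^ 2 * T ^ (1 - 2 * ω) := by positivity
  calc _ ≤ 3 * (T * (K:ℝ) ^ (-(2 * ω)) / ω + 16 * (1 + Real.log T) * T ^ (1 - 2 * ω)) +
      3 * (128 * C ^ 2 * T ^ (1 - 2 * ω)) + 3 * (2000 * C ^ 2 * T ^ (1 - 2 * ω)) := by
        linarith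
    _ = 3 * T * (K:ℝ) ^ (-(2 * ω)) / ω + 48 * (1 + Real.log T) * T ^ (1 - 2 * ω) + 6384 * (C ^ 2 * T ^ (1 - 2 * ω)) := by ring
    _ ≤ _ := by nlinarith


lemma mem_primesUpTo (x : ℝ) (p : ℕ) : p ∈ primesUpTo x ↔ p ≤ ⌊x⌋₊ ∧ p.Prime := by
  simp [primesUpTo, Nat.lt_succ_iff]

lemma primorial_pf (x : ℝ) : (primorial ⌊x⌋₊).primeFactors = primesUpTo x := by
  ext p
  rw [mem_primesUpTo, Nat.mem_primeFactors]
  constructor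
  · rintro ⟨h1, h2, _⟩; exact ⟨(h1.dvd_primorial_iff).mp h2, h1⟩
  · rintro ⟨h1, h2⟩; exact ⟨h2, (h2.dvd_primorial_iff).mpr h1, primorial_ne_zero _⟩

lemma psi_val (q : ℕ) [NeZero q] (χ : DirichletCharacter ℂ q) (x : ℝ)
    (hd : q ∣ primorial ⌊x⌋₊) (n : ℕ) :
    DirichletCharacter.changeLevel hd χ (n : ZMod (primorial ⌊x⌋₊)) =
      if ∀ p ∈ primesUpTo x, ¬ p ∣ n then χ (n : ZMod q) else 0 := by
  have hco : (∀ p ∈ primesUpTo x, ¬ p ∣ n) ↔ Nat.Coprime n (primorial ⌊x⌋₊) := by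
    constructor
    · intro h
      rw [Nat.coprime_iff_gcd_eq_one] 
      by_contra hne
      obtain ⟨p, hp, hpd⟩ := Nat.exists_prime_and_dvd hne
      refine h p ?_ (hpd.trans (Nat.gcd_dvd_left _ _))
      rw [mem_primesUpTo]
      exact ⟨(hp.dvd_primorial_iff).mp (hpd.trans (Nat.gcd_dvd_right _ _)), hp⟩
    · intro h p hp hpn
      rw [mem_primesUpTo] at hp
      have := Nat.dvd_gcd hpn ((hp.2.dvd_primorial_iff).mpr hp.1)
      rw [h] at this
      exact hp.2.one_lt.ne' (Nat.dvd_one.mp this)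
  split_ifs with h
  · rw [hco] at h
    have := DirichletCharacter.changeLevel_eq_cast_of_dvd' χ hd (a := (n:ℤ)) (by
      rw [Nat.isCoprime_iff_coprime]; exact h)
    simpa using this
  · rw [hco] at h
    apply MulChar.map_nonunit
    rw [ZMod.isUnit_iff_coprime]; exact h

lemma psi_sum (q : ℕ) [NeZero q] (χ : DirichletCharacter ℂ q) (x : ℝ)
    (hd : q ∣ primorial ⌊x⌋₊) : ∃ κ : ℂ, ∀ u : ℝ, 0 ≤ u →
    ‖∑ k ∈ Finset.Icc 1 ⌊u⌋₊, DirichletCharacter.changeLevel hd χ (k : ZMod (primorial ⌊x⌋₊)) - κ * u‖ ≤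
      2 ^ (primesUpTo x).card * (4 * q) := by
  have hb := periodic_sum q (NeZero.pos q) (fun n => χ (n : ZMod q)) (fun n => by simp)
    (fun n => DirichletCharacter.norm_le_one χ _)
  have := sieve_sum (fun n => χ (n : ZMod q)) (fun n => χ (n : ZMod q))
    (fun p _ => DirichletCharacter.norm_le_one χ _) (fun p m _ => by push_cast; rw [map_mul])
    (4 * q) hb (primesUpTo x) (fun p hp => ((mem_primesUpTo x p).mp hp).2)
  simpa only [psi_val] using this

lemma psi_zero (q : ℕ) [NeZero q] (χ : DirichletCharacter ℂ q) (x : ℝ)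
    (hd : q ∣ primorial ⌊x⌋₊) (n : ℕ) (h1 : 1 < n) (h2 : n ≤ ⌊x⌋₊) :
    DirichletCharacter.changeLevel hd χ (n : ZMod (primorial ⌊x⌋₊)) = 0 := by
  rw [psi_val, if_neg]
  push Not
  obtain ⟨p, hp, hpd⟩ := Nat.exists_prime_and_dvd h1.ne'
  exact ⟨p, (mem_primesUpTo x p).mpr ⟨(Nat.le_of_dvd (by omega) hpd).trans h2, hp⟩, hpd⟩

lemma card_primes (x : ℝ) (hx : 7 ≤ x) : ((primesUpTo x).card : ℝ) ≤ x / 3 + 6 := by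
  have hx0 : (⌊x⌋₊ : ℝ) ≤ x := Nat.floor_le (by linarith)
  have h7 : 7 ≤ ⌊x⌋₊ := Nat.le_floor (by exact_mod_cast hx)
  have e : (primesUpTo x).card = Nat.primeCounting' (⌊x⌋₊ + 1) := by
    rw [primesUpTo, Nat.primeCounting', Nat.count_eq_card_filter_range]
  obtain ⟨n, hn⟩ := Nat.exists_eq_add_of_le (show 7 ≤ ⌊x⌋₊ + 1 by omega)
  have h := Nat.primeCounting'_add_le (a := 6) (k := 7) (by norm_num) (by norm_num) n
  rw [← hn, ← e] at h
  have h3 : Nat.primeCounting' 7 = 3 := by decide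
  have h4 : Nat.totient 6 = 2 := by decide
  rw [h3, h4] at h
  have h5 : 3 * (primesUpTo x).card ≤ ⌊x⌋₊ + 18 := by omega
  have h6 : 3 * ((primesUpTo x).card : ℝ) ≤ ⌊x⌋₊ + 18 := by exact_mod_cast h5
  linarith

lemma factor_lower (q : ℕ) (hq : q = 1 ∨ q.Prime) (Q : ℝ) (hQ1 : Real.exp ((q : ℝ) ^ 8) < Q) (hQ2 : 355991 < Q) :
    156 ≤ ((q.totient : ℝ) / q) ^ 4 * (Real.log Q) ^ 2 := by
  have hl2 : 12.5 ≤ Real.log Q := by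
    rw [Real.le_log_iff_exp_le (by linarith)]
    have h1 : Real.exp 12.5 ^ 2 ≤ (355991:ℝ) ^ 2 := by
      rw [← Real.exp_nat_mul]
      have : ((2:ℕ):ℝ) * 12.5 = ((25:ℕ):ℝ) * 1 := by norm_num
      rw [this, Real.exp_nat_mul]
      calc _ ≤ (2.7182818286:ℝ) ^ 25 := by gcongr; exact Real.exp_one_lt_d9.le
        _ ≤ _ := by norm_num
    have := (pow_le_pow_iff_left₀ (Real.exp_pos _).le (by norm_num) two_ne_zero).mp h1
    linarith
  rcases hq with rfl | hp
  · simp; nlinarith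
  · have hl1 : (q:ℝ) ^ 8 ≤ Real.log Q := by
      rw [Real.le_log_iff_exp_le (by linarith)]; exact hQ1.le
    have hq2 : (2:ℝ) ≤ q := by exact_mod_cast hp.two_le
    have h1 : (1/2:ℝ) ≤ (q.totient : ℝ) / q := by
      rw [Nat.totient_prime hp, le_div_iff₀ (by linarith), Nat.cast_sub hp.one_le]
      push_cast; linarith
    calc (156:ℝ) ≤ (1/2) ^ 4 * (2 ^ 8) ^ 2 := by norm_num
      _ ≤ _ := by
        have : (2:ℝ) ^ 8 ≤ Real.log Q := (by gcongr : (2:ℝ) ^ 8 ≤ (q:ℝ) ^ 8).trans hl1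
        gcongr

lemma exp_num (q : ℕ) (hq0 : 1 ≤ q) (Q L C : ℝ) (c : ℕ) (hQ1 : Real.exp ((q : ℝ) ^ 8) < Q) (hQ2 : 355991 < Q)
    (hc : (c:ℝ) ≤ Q / 3 + 6) (hC : C = 2 ^ c * (4 * q)) (hL : 0.51 * (Q - 872) ≤ L) :
    (12 + 24 * L + 2500 * C ^ 2) * Q ≤ 65 * Real.exp L := by
  have hL2 : 0.5 * Q ≤ L := by linarith
  have hL0 : 100000 ≤ L := by linarith
  have hq1 : (1:ℝ) ≤ q := by exact_mod_cast hq0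
  have hqQ : (q:ℝ) ^ 2 ≤ Q := by
    have h1 : (q:ℝ) ^ 2 ≤ (q:ℝ) ^ 8 := pow_le_pow_right₀ hq1 (by norm_num)
    have h2 := Real.add_one_le_exp ((q:ℝ) ^ 8)
    linarith
  have h1 : (12 + 24 * L) * Q ≤ 33 * Real.exp L := by
    have h3 := Real.pow_div_factorial_le_exp L (by linarith) 3
    have h4 : L ^ 2 * 100000 ≤ L ^ 3 := by nlinarith [sq_nonneg L]
    have h5 : (12 + 24 * L) * Q ≤ (25 * L) * (2 * L) := by gcongr <;> linarith
    norm_num [Nat.factorial] at h3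
    nlinarith [sq_nonneg L]
  have hC2 : C ^ 2 ≤ 65536 * Q * Real.exp (0.4622 * Q) := by
    have e : C ^ 2 = 16 * (q:ℝ) ^ 2 * (4:ℝ) ^ c := by
      rw [hC, mul_pow, ← pow_mul, mul_comm c 2, pow_mul]; norm_num; ring
    have e2 : (4:ℝ) ^ c ≤ 4096 * Real.exp (0.4622 * Q) := by
      have l4 : Real.log 4 ≤ 1.3864 := by
        rw [show (4:ℝ) = 2 ^ 2 by norm_num, Real.log_pow]
        have := Real.log_two_lt_d9; push_cast; linarith
      have l40 : 0 ≤ Real.log 4 := Real.log_nonneg (by norm_num)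
      calc (4:ℝ) ^ c = (4:ℝ) ^ (c:ℝ) := (Real.rpow_natCast _ _).symm
        _ ≤ (4:ℝ) ^ (Q / 3 + (6:ℕ)) := by gcongr; norm_num; push_cast; exact hc
        _ = (4:ℝ) ^ 6 * (4:ℝ) ^ (Q / 3) := by
            rw [Real.rpow_add (by norm_num), Real.rpow_natCast, mul_comm]
        _ ≤ _ := by
            rw [Real.rpow_def_of_pos (by norm_num)]
            have : Real.log 4 * (Q / 3) ≤ 0.4622 * Q := by nlinarith
            norm_num at this ⊢
            linarith
    rw [e]
    calc _ ≤ 16 * Q * (4096 * Real.exp (0.4622 * Q)) := by gcongr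
      _ = _ := by ring
  have h2 : 2500 * C ^ 2 * Q ≤ 32 * Real.exp L := by
    have e1 : Q ^ 2 ≤ 1250 * Real.exp (0.04 * Q) := by
      have h3 := Real.pow_div_factorial_le_exp (0.04 * Q) (by linarith) 2
      norm_num [Nat.factorial] at h3 ⊢
      nlinarith
    have e2 : (10:ℝ) ^ 10 ≤ Real.exp 2300 := by
      have h3 := Real.pow_div_factorial_le_exp (2300) (by norm_num) 4
      norm_num [Nat.factorial] at h3
      have : (10:ℝ) ^ 10 ≤ 27984100000000 / 24 := by norm_num
      linarith
    have e3 : Real.exp (0.4622 * Q) * Real.exp (0.04 * Q) * Real.exp 2300 ≤ Real.exp L := by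
      rw [← Real.exp_add, ← Real.exp_add]
      apply Real.exp_le_exp.mpr; linarith
    calc 2500 * C ^ 2 * Q ≤ 2500 * (65536 * Q * Real.exp (0.4622 * Q)) * Q := by gcongr
      _ = 2500 * 65536 * Real.exp (0.4622 * Q) * Q ^ 2 := by ring
      _ ≤ 2500 * 65536 * Real.exp (0.4622 * Q) * (1250 * Real.exp (0.04 * Q)) := by gcongr
      _ = 32 * (Real.exp (0.4622 * Q) * Real.exp (0.04 * Q) * 6400000000) := by ring
      _ ≤ 32 * (Real.exp (0.4622 * Q) * Real.exp (0.04 * Q) * Real.exp 2300) := by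
          gcongr; refine le_trans ?_ e2; norm_num
      _ ≤ _ := by gcongr
  nlinarith

lemma numerics (q : ℕ) (hq : q = 1 ∨ q.Prime) (Q T ω C : ℝ) (c : ℕ) (hω0 : 0 < ω) (hω4 : ω < 1 / 4)
    (hQ1 : Real.exp ((q : ℝ) ^ 8) < Q) (hQ2 : 355991 < Q)
    (hc : (c:ℝ) ≤ Q / 3 + 6) (hC : C = 2 ^ c * (4 * q))
    (hT : T ≥ Real.pi * Real.exp (0.51 * (1 - 2 * ω) * (Q - 872) / ω)) :
    0.2 * (3 * T * (⌊Q⌋₊:ℝ) ^ (-(2 * ω)) / ω + (48 * (1 + Real.log T) + 10000 * C ^ 2) * T ^ (1 - 2 * ω)) ≤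
      0.0062 * T * ((q.totient : ℝ) / q) ^ 4 * (Real.log Q) ^ 2 / (ω ^ 3 * Q ^ (2 * ω)) := by
  have hF := factor_lower q hq Q hQ1 hQ2
  set F := ((q.totient : ℝ) / q) ^ 4 * (Real.log Q) ^ 2 with hFdef
  have hQ0 : 0 < Q := by linarith
  have hq0 : 1 ≤ q := by
    rcases hq with rfl | h
    · exact le_rfl
    · exact h.one_le
  have hTe : Real.exp (0.51 * (1 - 2 * ω) * (Q - 872) / ω) ≤ T := by
    have := Real.pi_gt_three
    have h2 := Real.exp_pos (0.51 * (1 - 2 * ω) * (Q - 872) / ω)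
    nlinarith
  have hT0 : 0 < T := lt_of_lt_of_le (Real.exp_pos _) hTe
  set L := 2 * ω * Real.log T with hLdef
  have hL : 0.51 * (Q - 872) ≤ L := by
    have h1 : 0.51 * (1 - 2 * ω) * (Q - 872) / ω ≤ Real.log T := by
      rw [Real.le_log_iff_exp_le hT0]; exact hTe
    rw [div_le_iff₀ hω0] at h1
    nlinarith
  have hY : T ^ (2 * ω) = Real.exp L := by
    rw [Real.rpow_def_of_pos hT0, hLdef]; ring_nf
  have hE := exp_num q hq0 Q L C c hQ1 hQ2 hc hC hL
  set B := Q ^ (-(2 * ω)) with hB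
  have hB0 : 0 < B := by positivity
  have hBQ : 1 ≤ B * Q := by
    rw [hB]
    calc (1:ℝ) ≤ Q ^ (-(2 * ω) + 1) := Real.one_le_rpow (by linarith) (by linarith)
      _ = _ := by rw [Real.rpow_add hQ0, Real.rpow_one]
  have hR : 15 * T * B / ω ≤ 0.0062 * T * ((q.totient : ℝ) / q) ^ 4 * (Real.log Q) ^ 2 / (ω ^ 3 * Q ^ (2 * ω)) := by
    have e : 0.0062 * T * ((q.totient : ℝ) / q) ^ 4 * (Real.log Q) ^ 2 / (ω ^ 3 * Q ^ (2 * ω)) =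
        T * B / ω * (0.0062 * F / ω ^ 2) := by
      rw [hB, Real.rpow_neg hQ0.le, hFdef]; field_simp
    rw [e]
    have : 15 ≤ 0.0062 * F / ω ^ 2 := by
      rw [le_div_iff₀ (by positivity)]; nlinarith
    calc 15 * T * B / ω = T * B / ω * 15 := by ring
      _ ≤ _ := by gcongr
  refine le_trans ?_ hR
  have hfl : (⌊Q⌋₊:ℝ) ^ (-(2 * ω)) ≤ 2 * B := by
    have h1 : Q / 2 ≤ (⌊Q⌋₊:ℝ) := by have := Nat.lt_floor_add_one Q; linarith
    calc _ ≤ (Q / 2) ^ (-(2 * ω)) := Real.rpow_le_rpow_of_nonpos (by linarith) h1 (by linarith)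
      _ = (2:ℝ) ^ (2 * ω) * B := by
          rw [Real.div_rpow hQ0.le (by norm_num), Real.rpow_neg (by norm_num : (0:ℝ) ≤ 2)]; field_simp; rfl
      _ ≤ (2:ℝ) ^ (1:ℝ) * B := by gcongr; norm_num; linarith
      _ = _ := by rw [Real.rpow_one]
  have hm : 3 * T * (⌊Q⌋₊:ℝ) ^ (-(2 * ω)) / ω ≤ 6 * T * B / ω := by
    calc _ ≤ 3 * T * (2 * B) / ω := by gcongr
      _ = _ := by ring
  have he : (48 * (1 + Real.log T) + 10000 * C ^ 2) * T ^ (1 - 2 * ω) ≤ 65 * T * B / ω := by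
    rw [Real.rpow_sub hT0, Real.rpow_one, hY, le_div_iff₀ hω0]
    have h1 : ω * (48 * (1 + Real.log T) + 10000 * C ^ 2) ≤ 12 + 24 * L + 2500 * C ^ 2 := by
      have : 0 ≤ C ^ 2 := sq_nonneg C
      rw [hLdef]; nlinarith
    have h2 : ω * (48 * (1 + Real.log T) + 10000 * C ^ 2) ≤ 65 * Real.exp L * B := by
      have hX : 0 ≤ 12 + 24 * L + 2500 * C ^ 2 := by nlinarith [sq_nonneg C]
      calc _ ≤ 12 + 24 * L + 2500 * C ^ 2 := h1
        _ ≤ (12 + 24 * L + 2500 * C ^ 2) * (B * Q) := le_mul_of_one_le_right hX hBQ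
        _ = (12 + 24 * L + 2500 * C ^ 2) * Q * B := by ring
        _ ≤ _ := by gcongr
    calc _ = (ω * (48 * (1 + Real.log T) + 10000 * C ^ 2)) * (T / Real.exp L) := by ring
      _ ≤ (65 * Real.exp L * B) * (T / Real.exp L) := by gcongr
      _ = _ := by field_simp
  have hp : 0 ≤ T * B / ω := by positivity
  calc _ ≤ 0.2 * (6 * T * B / ω + 65 * T * B / ω) := by gcongr
    _ = 14.2 * (T * B / ω) := by ring
    _ ≤ 15 * (T * B / ω) := by gcongr; norm_num
    _ = _ := by ring

end helpers

lemma shift_bound (g : ℝ → ℝ) (hg0 : ∀ t, 0 ≤ g t) (T y B : ℝ) (hT : 4 ≤ T) (hy : |y| ≤ 1 / 4)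
    (hgi : IntegrableOn g (Set.Icc (T / 4) (2 * T))) (hB : ∫ t in Set.Icc (T / 4) (2 * T), g t ≤ B) :
    ∫ t in Set.Icc (T / 2) T, g (t + y) ≤ B := by
  have hy' := abs_le.mp hy
  rw [integral_Icc_eq_integral_Ioc, ← intervalIntegral.integral_of_le (by linarith),
    intervalIntegral.integral_comp_add_right, intervalIntegral.integral_of_le (by linarith),
    ← integral_Icc_eq_integral_Ioc]
  refine le_trans ?_ hB
  exact setIntegral_mono_set hgi (Filter.Eventually.of_forall hg0)
    (Set.Icc_subset_Icc (by linarith) (by linarith)).eventuallyLE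

lemma double_bound (M : ℕ) [NeZero M] (ψ : DirichletCharacter ℂ M) (d T B : ℝ) (hd0 : 0 < d) (hd : d < 1 / 4)
    (hT : 4 ≤ T) (hB : ∀ σ : ℝ, 3 / 4 - d ≤ σ → σ ≤ 3 / 4 + d →
      ∫ t in Set.Icc (T / 4) (2 * T), ‖DirichletCharacter.LFunction ψ ((σ:ℂ) + t * Complex.I) - 1‖ ^ 2 ≤ B) :
    (∫ τ in Set.Icc (T / 2) T, ∫ s in Metric.closedBall (0 : ℂ) d,
      ‖DirichletCharacter.LFunction ψ (s + 3 / 4 + τ * Complex.I) - 1‖ ^ 2) ≤ 0.2 * B := by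
  have hB0 : 0 ≤ B := (setIntegral_nonneg measurableSet_Icc fun t _ => by positivity).trans
    (hB (3 / 4) (by linarith) (by linarith))
  have him : ∀ s ∈ Metric.closedBall (0:ℂ) d, |s.im| ≤ d := fun s hs =>
    (Complex.abs_im_le_norm s).trans (by simpa using hs)
  have hre : ∀ s ∈ Metric.closedBall (0:ℂ) d, |s.re| ≤ d := fun s hs =>
    (Complex.abs_re_le_norm s).trans (by simpa using hs)
  have hcL : ∀ z : ℂ, 0 < z.im → ContinuousAt (DirichletCharacter.LFunction ψ) z := fun z hz =>
    (DirichletCharacter.differentiableAt_LFunction ψ z (Or.inl (by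
      rintro rfl; simp at hz))).continuousAt
  rw [integral_integral_swap]
  · have hn := norm_setIntegral_le_of_norm_le_const (μ := volume) (s := Metric.closedBall (0:ℂ) d) (C := B)
      (f := fun s : ℂ => ∫ τ in Set.Icc (T / 2) T,
        ‖DirichletCharacter.LFunction ψ (s + 3 / 4 + τ * Complex.I) - 1‖ ^ 2)
      (isCompact_closedBall _ _).measure_lt_top (by
        intro s hs
        rw [Real.norm_of_nonneg (setIntegral_nonneg measurableSet_Icc fun t _ => by positivity)]
        have h1 := him s hs
        have h2 := abs_le.mp (hre s hs)
        have hcg : ContinuousOn (fun t : ℝ => ‖DirichletCharacter.LFunction ψ (((s.re + 3 / 4 : ℝ):ℂ) + t * Complex.I) - 1‖ ^ 2)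
            (Set.Icc (T / 4) (2 * T)) := by
          intro t ht
          have := ht.1
          refine ContinuousAt.continuousWithinAt ?_
          refine ((ContinuousAt.sub ?_ continuousAt_const).norm).pow 2
          exact ContinuousAt.comp (g := DirichletCharacter.LFunction ψ)
            (f := fun t : ℝ => ((s.re + 3 / 4 : ℝ):ℂ) + t * Complex.I) (hcL _ (by simp; linarith))
            (by fun_prop)
        have := shift_bound (fun t : ℝ => ‖DirichletCharacter.LFunction ψ (((s.re + 3 / 4 : ℝ):ℂ) + t * Complex.I) - 1‖ ^ 2)
          (fun t => by positivity) T s.im B hT (by linarith) (hcg.integrableOn_compact isCompact_Icc)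
          (hB (s.re + 3 / 4) (by linarith) (by linarith))
        refine le_trans (le_of_eq ?_) this
        congr 1
        ext t
        congr 4
        apply Complex.ext <;> simp
        ring)
    have hv : volume.real (Metric.closedBall (0:ℂ) d) ≤ 0.2 := by
      rw [measureReal_def, Complex.volume_closedBall, ENNReal.toReal_mul, ENNReal.toReal_pow,
        ENNReal.toReal_ofReal hd0.le]
      simp only [ENNReal.coe_toReal, NNReal.coe_real_pi]
      have := Real.pi_lt_d2
      have := Real.pi_pos
      have : d ^ 2 ≤ (1 / 4) ^ 2 := by gcongr
      calc d ^ 2 * Real.pi ≤ (1 / 4) ^ 2 * 3.15 := by gcongr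
        _ ≤ _ := by norm_num
    calc _ ≤ _ := le_abs_self _
      _ ≤ _ := hn
      _ ≤ B * 0.2 := by gcongr
      _ = _ := by ring
  · rw [Measure.prod_restrict]
    refine ContinuousOn.integrableOn_compact (isCompact_Icc.prod (isCompact_closedBall _ _)) ?_
    rintro ⟨τ, s⟩ ⟨h1, h2⟩
    have h3 := abs_le.mp (him s h2)
    have h4 := h1.1
    simp only at h4
    refine ContinuousAt.continuousWithinAt ?_
    refine ((ContinuousAt.sub ?_ continuousAt_const).norm).pow 2
    exact ContinuousAt.comp (g := DirichletCharacter.LFunction ψ)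
      (f := fun x : ℝ × ℂ => x.2 + 3 / 4 + x.1 * Complex.I) (hcL _ (by simp; linarith))
      (by fun_prop)

/-- Mean square estimate for `L(s + 3/4 + iτ, χ) L_Q^{-1}(s + 3/4 + iτ, χ) - 1`
over `τ ∈ [T/2, T]` and `s` in the disc `|s| ≤ d`. -/
theorem stmt_11 (q : ℕ) (hq : q = 1 ∨ q.Prime) [NeZero q] (χ : DirichletCharacter ℂ q)
    (d ω Q T : ℝ) (hd0 : 0 < d) (hd : d < 1 / 4) (hω : ω = 1 / 4 - d)
    (hQ : Q > max (Real.exp ((q : ℝ) ^ 8)) 355991)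
    (hT : T ≥ Real.pi * Real.exp (0.51 * (1 - 2 * ω) * (Q - 872) / ω)) :
    (∫ τ in Set.Icc (T / 2) T, ∫ s in Metric.closedBall (0 : ℂ) d,
      (norm (E := ℂ) (DirichletCharacter.LFunction χ (s + 3 / 4 + τ * Complex.I) *
          (∏ p ∈ primesUpTo Q,
            (1 - χ (p : ZMod q) * (p : ℂ) ^ (-(s + 3 / 4 + τ * Complex.I)))) - 1)) ^ 2) ≤
      0.0062 * T * ((q.totient : ℝ) / q) ^ 4 * (Real.log Q) ^ 2 / (ω ^ 3 * Q ^ (2 * ω)) := by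
  have hQ1 : Real.exp ((q : ℝ) ^ 8) < Q := lt_of_le_of_lt (le_max_left _ _) hQ
  have hQ2 : 355991 < Q := lt_of_le_of_lt (le_max_right _ _) hQ
  have hω0 : 0 < ω := by linarith
  have hω4 : ω < 1 / 4 := by linarith
  have hq0 : 1 ≤ q := NeZero.one_le
  have hq1 : (1:ℝ) ≤ q := by exact_mod_cast hq0
  have hT4 : 4 ≤ T := by
    have h1 : 1 ≤ 0.51 * (1 - 2 * ω) * (Q - 872) / ω := by
      rw [le_div_iff₀ hω0]; nlinarith
    have h2 := Real.add_one_le_exp (0.51 * (1 - 2 * ω) * (Q - 872) / ω)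
    have h3 := Real.pi_gt_three
    nlinarith
  have hqd : q ∣ primorial ⌊Q⌋₊ := by
    rcases hq with rfl | hp
    · exact one_dvd _
    · rw [hp.dvd_primorial_iff]
      apply Nat.le_floor
      have h1 : (q:ℝ) ^ 1 ≤ (q:ℝ) ^ 8 := pow_le_pow_right₀ hq1 (by norm_num)
      have h2 := Real.add_one_le_exp ((q:ℝ) ^ 8)
      linarith
  haveI : NeZero (primorial ⌊Q⌋₊) := ⟨primorial_ne_zero _⟩
  obtain ⟨κ, hκ⟩ := psi_sum q χ Q hqd
  set C : ℝ := 2 ^ (primesUpTo Q).card * (4 * q) with hC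
  have hC1 : 1 ≤ C := by
    have : (1:ℝ) ≤ 2 ^ (primesUpTo Q).card := one_le_pow₀ (by norm_num)
    nlinarith
  have hK : 1 ≤ ⌊Q⌋₊ := Nat.le_floor (by push_cast; linarith)
  refine le_trans (le_of_eq ?_) ((double_bound (primorial ⌊Q⌋₊) (DirichletCharacter.changeLevel hqd χ) d T _ hd0 hd hT4
    (fun σ h1 h2 => mean_sq _ _ κ C hC1 hκ ⌊Q⌋₊ hK (fun n => psi_zero q χ Q hqd n) σ ω hω0 hω4
      (by linarith) (by linarith) T hT4)).trans
    (numerics q hq Q T ω C (primesUpTo Q).card hω0 hω4 hQ1 hQ2 (card_primes Q (by linarith)) hC hT))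
  refine setIntegral_congr_fun measurableSet_Icc fun τ hτ => ?_
  refine setIntegral_congr_fun Metric.isClosed_closedBall.measurableSet fun s hs => ?_
  have h1 : |s.im| ≤ d := (Complex.abs_im_le_norm s).trans (by simpa using hs)
  have hne : s + 3 / 4 + τ * Complex.I ≠ 1 := by
    intro h
    have h2 := congrArg Complex.im h
    simp at h2
    have := abs_le.mp h1
    have := hτ.1
    linarith
  rw [DirichletCharacter.LFunction_changeLevel hqd χ (Or.inr hne), primorial_pf]
end

section
/- Let q be a positive integer, χ a Dirichlet character modulo q, and let λ_p, λ'_p be real numbers indexed by primes p. Then for M > 355991 and every s with |s| ≤ r < 1/4, | ∑_{p ≤ M} log(1 − χ(p) e^{2πi λ_p} p^{−(s+3/4)}) − ∑_{p ≤ M} log(1 − χ(p) e^{2πi λ'_p} p^{−(s+3/4)}) | ≤ 184 (M^{1/4+r}/log M) · max_{p ≤ M} ‖λ_p − λ'_p‖. -/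
/-- The distance from a real number to the nearest integer. -/
noncomputable def nearIntDist (x : ℝ) : ℝ := |x - round x|

/-- Fourth root. -/
noncomputable def frt (x : ℝ) : ℝ := x ^ ((1 : ℝ) / 4)

lemma frt_pow {x : ℝ} (hx : 0 ≤ x) : frt x ^ 4 = x := by
  unfold frt
  rw [← Real.rpow_natCast, ← Real.rpow_mul hx]; norm_num

lemma frt_pos {x : ℝ} (hx : 0 < x) : 0 < frt x := Real.rpow_pos_of_pos hx _

lemma frt_mono {x y : ℝ} (hx : 0 ≤ x) (h : x ≤ y) : frt x ≤ frt y :=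
  Real.rpow_le_rpow hx h (by norm_num)

lemma rpow_34 {x : ℝ} (hx : 0 < x) : x ^ (-(3 / 4 : ℝ)) = 1 / frt x ^ 3 := by
  unfold frt
  rw [← Real.rpow_natCast, ← Real.rpow_mul hx.le, Real.rpow_neg hx.le, one_div]; norm_num

lemma rpow_12 {x : ℝ} (hx : 0 < x) : x ^ (-(1 / 2 : ℝ)) = 1 / frt x ^ 2 := by
  unfold frt
  rw [← Real.rpow_natCast, ← Real.rpow_mul hx.le, Real.rpow_neg hx.le, one_div]; norm_num

/-- weight -/
noncomputable def wt (p : ℕ) : ℝ := 1 / (frt p * (frt p ^ 2 - 1))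

lemma diff_ge {a b : ℝ} (hb : 0 < b) (h : a ^ 4 = b ^ 4 + 1) (ha : 0 < a) :
    1 / a ^ 3 ≤ 4 * (a - b) := by
  have hab : b ≤ a := by
    by_contra hc
    push Not at hc
    have : a ^ 4 ≤ b ^ 4 := by gcongr
    linarith
  rw [div_le_iff₀ (by positivity)]
  have h1 : (a - b) * (a ^ 3 + a ^ 2 * b + a * b ^ 2 + b ^ 3) = 1 := by linear_combination h
  have h2 : a ^ 3 + a ^ 2 * b + a * b ^ 2 + b ^ 3 ≤ 4 * a ^ 3 := by
    have e1 : a ^ 2 * b ≤ a ^ 2 * a := by gcongr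
    have e2 : a * b ^ 2 ≤ a * a ^ 2 := by gcongr
    have e3 : b ^ 3 ≤ a ^ 3 := by gcongr
    nlinarith
  nlinarith [mul_le_mul_of_nonneg_left h2 (sub_nonneg.2 hab)]

lemma frt_step (n : ℕ) : frt ((n + 1 : ℕ) : ℝ) ^ 4 = frt (n : ℝ) ^ 4 + 1 := by
  rw [frt_pow (by positivity), frt_pow (by positivity)]; push_cast; ring

lemma wt_nonneg {p : ℕ} (hp : 1 ≤ p) : 0 ≤ wt p := by
  unfold wt
  have h0 : 0 < frt p := frt_pos (by positivity)
  have h : 1 ≤ frt p := by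
    have h4 : frt p ^ 4 = p := frt_pow (by positivity)
    have : (1 : ℝ) ≤ p := by exact_mod_cast hp
    by_contra hc
    push Not at hc
    have : frt p ^ 4 < 1 := pow_lt_one₀ h0.le hc (by norm_num)
    linarith
  have : 0 ≤ frt p ^ 2 - 1 := by nlinarith
  positivity

lemma wt_step {n : ℕ} (hn : 4 ≤ n) :
    wt (n + 1) ≤ 7.3 * (frt ((n + 1 : ℕ) : ℝ) - frt (n : ℝ)) := by
  have hn0 : 0 < n := by omega
  have hb : 0 < frt (n : ℝ) := frt_pos (by positivity)
  have ha : 0 < frt ((n + 1 : ℕ) : ℝ) := frt_pos (by positivity)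
  have hd := diff_ge hb (frt_step n) ha
  have h4 : frt ((n + 1 : ℕ) : ℝ) ^ 4 = ((n + 1 : ℕ) : ℝ) := frt_pow (by positivity)
  have hn5 : (5 : ℝ) ≤ ((n + 1 : ℕ) : ℝ) := by exact_mod_cast (by omega : 5 ≤ n + 1)
  unfold wt
  set a := frt ((n + 1 : ℕ) : ℝ)
  have h2 : 2.22 ≤ a ^ 2 := by nlinarith [sq_nonneg a]
  have : 1 / (a * (a ^ 2 - 1)) ≤ 1.825 * (1 / a ^ 3) := by
    rw [mul_one_div, div_le_div_iff₀ (by apply mul_pos ha; linarith) (by positivity)]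
    nlinarith [mul_le_mul_of_nonneg_left h2 ha.le]
  linarith

lemma part1 (N : ℕ) (hN : 4 ≤ N) :
    ∑ p ∈ (Finset.range (N + 1)).filter Nat.Prime, wt p ≤ 7.3 * frt N - 7 := by
  induction N, hN using Nat.le_induction with
  | base =>
    have e : (Finset.range (4 + 1)).filter Nat.Prime = {2, 3} := by decide
    rw [e, Finset.sum_pair (by norm_num)]
    have h2 : frt ((2 : ℕ) : ℝ) ^ 4 = 2 := by rw [frt_pow (by norm_num)]; norm_num
    have h3 : frt ((3 : ℕ) : ℝ) ^ 4 = 3 := by rw [frt_pow (by norm_num)]; norm_num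
    have h4 : frt ((4 : ℕ) : ℝ) ^ 4 = 4 := by rw [frt_pow (by norm_num)]; norm_num
    have p2 : 0 < frt ((2 : ℕ) : ℝ) := frt_pos (by norm_num)
    have p3 : 0 < frt ((3 : ℕ) : ℝ) := frt_pos (by norm_num)
    have p4 : 0 < frt ((4 : ℕ) : ℝ) := frt_pos (by norm_num)
    unfold wt
    have lb : ∀ x c : ℝ, 0 < x → c ^ 4 ≤ x ^ 4 → c ≤ x := fun x c hx h => by
      by_contra hc
      push Not at hc
      have : x ^ 4 < c ^ 4 := by gcongr
      linarith
    have l2 := lb _ 1.189 p2 (by rw [h2]; norm_num)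
    have l3 := lb _ 1.316 p3 (by rw [h3]; norm_num)
    have l4 := lb _ 1.414 p4 (by rw [h4]; norm_num)
    have b2 : 1 / (frt ((2 : ℕ) : ℝ) * (frt ((2 : ℕ) : ℝ) ^ 2 - 1)) ≤
        1 / (1.189 * (1.189 ^ 2 - 1)) := by
      gcongr
    have b3 : 1 / (frt ((3 : ℕ) : ℝ) * (frt ((3 : ℕ) : ℝ) ^ 2 - 1)) ≤
        1 / (1.316 * (1.316 ^ 2 - 1)) := by
      gcongr
    norm_num at b2 b3 l4 ⊢
    linarith
  | succ n hn ih =>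
    rw [Finset.range_add_one, Finset.filter_insert]
    have h := wt_step hn
    split_ifs with hp
    · rw [Finset.sum_insert (by simp)]
      linarith
    · have := wt_nonneg (p := n + 1) (by omega)
      linarith

/-- prime log indicator -/
noncomputable def cc (n : ℕ) : ℝ := if n.Prime then Real.log n else 0

lemma theta_cc (N : ℕ) : ∑ n ∈ Finset.range (N + 1), cc n ≤ Real.log 4 * N := by
  have := Chebyshev.theta_le_log4_mul_x (x := N) (by positivity)
  rw [Chebyshev.theta_eq_sum_Icc] at this
  simp only [Nat.floor_natCast] at this
  unfold cc
  rw [← Finset.sum_filter, Finset.range_eq_Ico]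
  exact this

lemma abel (N : ℕ) (hN : 1 ≤ N) :
    ∑ n ∈ Finset.range (N + 1), cc n * (1 / frt n ^ 3) ≤
      (1 / frt N ^ 3) * (∑ n ∈ Finset.range (N + 1), cc n - Real.log 4 * N)
        + 4 * Real.log 4 * frt N := by
  have hl : 0 < Real.log 4 := Real.log_pos (by norm_num)
  induction N, hN using Nat.le_induction with
  | base =>
    have : frt ((1 : ℕ) : ℝ) = 1 := by simp [frt]
    simp [Finset.sum_range_succ, cc, frt, Nat.not_prime_zero, Nat.not_prime_one]
    linarith
  | succ n hn ih =>
    rw [Finset.sum_range_succ, Finset.sum_range_succ _ (n + 1)]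
    have hb : 0 < frt (n : ℝ) := frt_pos (by positivity)
    have ha : 0 < frt ((n + 1 : ℕ) : ℝ) := frt_pos (by positivity)
    have hd := diff_ge hb (frt_step n) ha
    have hab : frt (n : ℝ) ≤ frt ((n + 1 : ℕ) : ℝ) := frt_mono (by positivity) (by simp)
    have hf : 1 / frt ((n + 1 : ℕ) : ℝ) ^ 3 ≤ 1 / frt (n : ℝ) ^ 3 := by gcongr
    have ht := theta_cc n
    set f1 := 1 / frt ((n + 1 : ℕ) : ℝ) ^ 3
    set f0 := 1 / frt (n : ℝ) ^ 3
    set S := ∑ n ∈ Finset.range (n + 1), cc n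
    have k1 := mul_le_mul_of_nonneg_right hf (sub_nonneg.2 ht)
    have k2 := mul_le_mul_of_nonneg_left hd hl.le
    push_cast at *
    linarith

lemma part2 (N : ℕ) (hN : 1 ≤ N) :
    ∑ n ∈ Finset.range (N + 1), cc n * (1 / frt n ^ 3) ≤ 4 * Real.log 4 * frt N := by
  have h := abel N hN
  have ht := theta_cc N
  have : (0 : ℝ) ≤ 1 / frt N ^ 3 := by
    have := frt_pos (x := N) (by positivity)
    positivity
  nlinarith [mul_le_mul_of_nonneg_left (sub_nonpos.2 ht) this]

lemma wt_large {M : ℝ} (hM : 355991 < M) {p : ℕ} (hp : p.Prime) (h : √M < p) :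
    wt p ≤ (24 / 23 * 2 / Real.log M) * (cc p * (1 / frt p ^ 3)) := by
  have hM0 : 0 < M := by linarith
  have hlM : 0 < Real.log M := Real.log_pos (by linarith)
  have hs : (596 : ℝ) < √M := Real.lt_sqrt_of_sq_lt (by linarith)
  have hp0 : (0 : ℝ) < p := by linarith
  have hlog : Real.log M / 2 ≤ Real.log p := by
    rw [← Real.log_sqrt hM0.le]
    exact Real.log_le_log (by linarith) h.le
  have hb := frt_pos hp0
  have h4 := frt_pow hp0.le
  have h24 : 24 ≤ frt p ^ 2 := by nlinarith [sq_nonneg (frt p)]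
  rw [cc, if_pos hp]
  unfold wt
  set a := frt p
  have h1 : 1 / (a * (a ^ 2 - 1)) ≤ 24 / 23 * (1 / a ^ 3) := by
    rw [mul_one_div, div_le_div_iff₀ (by apply mul_pos hb; linarith) (by positivity)]
    nlinarith [mul_le_mul_of_nonneg_left h24 hb.le]
  have h2 : 1 ≤ 2 / Real.log M * Real.log p := by
    rw [div_mul_eq_mul_div, le_div_iff₀ hlM]; linarith
  have h3 : 0 ≤ 24 / 23 * (1 / a ^ 3) := by positivity
  calc _ ≤ 24 / 23 * (1 / a ^ 3) * 1 := by linarith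
    _ ≤ 24 / 23 * (1 / a ^ 3) * (2 / Real.log M * Real.log p) := by gcongr
    _ = _ := by ring

lemma sum_wt {M : ℝ} (hM : 355991 < M) :
    ∑ p ∈ primesUpTo M, wt p ≤ 29.28 * (frt M / Real.log M) := by
  have hM0 : 0 < M := by linarith
  have hlM : 0 < Real.log M := Real.log_pos (by linarith)
  have hs : (596 : ℝ) < √M := Real.lt_sqrt_of_sq_lt (by linarith)
  have hl4 : Real.log 4 ≤ 1.3864 := by
    have : Real.log 4 = 2 * Real.log 2 := by
      rw [show (4 : ℝ) = 2 ^ 2 by norm_num, Real.log_pow]; norm_num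
    have := Real.log_two_lt_d9
    linarith
  have hsplit : ∑ p ∈ primesUpTo M, wt p ≤
      ∑ p ∈ (Finset.range (⌊√M⌋₊ + 1)).filter Nat.Prime, wt p +
      ∑ n ∈ Finset.range (⌊M⌋₊ + 1),
        (24 / 23 * 2 / Real.log M) * (cc n * (1 / frt n ^ 3)) := by
    rw [← Finset.sum_filter_add_sum_filter_not (primesUpTo M) (fun p : ℕ => (p : ℝ) ≤ √M)]
    refine add_le_add ?_ ?_
    · refine Finset.sum_le_sum_of_subset_of_nonneg ?_ ?_
      · intro p hp
        simp only [primesUpTo, Finset.mem_filter, Finset.mem_range] at hp ⊢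
        exact ⟨Nat.lt_succ_of_le (Nat.le_floor hp.2), hp.1.2⟩
      · intro p hp _
        simp only [Finset.mem_filter] at hp
        exact wt_nonneg hp.2.one_lt.le
    · refine (Finset.sum_le_sum (g := fun n : ℕ =>
        (24 / 23 * 2 / Real.log M) * (cc n * (1 / frt n ^ 3))) ?_).trans ?_
      · intro p hp
        simp only [primesUpTo, Finset.mem_filter] at hp
        exact wt_large hM hp.1.2 (not_le.1 hp.2)
      · refine Finset.sum_le_sum_of_subset_of_nonneg ?_ ?_
        · intro p hp
          simp only [primesUpTo, Finset.mem_filter] at hp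
          exact hp.1.1
        · intro p _ _
          have : 0 ≤ cc p := by
            unfold cc
            split_ifs
            · exact Real.log_natCast_nonneg p
            · exact le_rfl
          have : 0 ≤ frt p := Real.rpow_nonneg (by positivity) _
          positivity
  rw [← Finset.mul_sum] at hsplit
  have h1 := part1 ⌊√M⌋₊ (Nat.le_floor (by norm_num; linarith))
  have h2 := part2 ⌊M⌋₊ (Nat.le_floor (by norm_num; linarith))
  have h3 : frt (⌊√M⌋₊ : ℝ) ≤ frt √M :=
    frt_mono (by positivity) (Nat.floor_le (by positivity))
  have h4 : frt (⌊M⌋₊ : ℝ) ≤ frt M :=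
    frt_mono (by positivity) (Nat.floor_le (by positivity))
  have hu : 0 < frt √M := frt_pos (by linarith)
  have hu2 : frt M = frt √M ^ 2 := by
    unfold frt
    rw [pow_two, ← Real.mul_rpow (by positivity) (by positivity), Real.mul_self_sqrt hM0.le]
  have hlogu : Real.log M = 8 * Real.log (frt √M) := by
    unfold frt
    rw [Real.log_rpow (by linarith), Real.log_sqrt hM0.le]; ring
  have hfM : 0 < frt M := frt_pos hM0
  have hK : ∑ n ∈ Finset.range (⌊M⌋₊ + 1), cc n * (1 / frt n ^ 3) ≤ 4 * 1.3864 * frt M := by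
    refine h2.trans ?_
    have hl0 : 0 < Real.log 4 := Real.log_pos (by norm_num)
    have hf0 : 0 ≤ frt (⌊M⌋₊ : ℝ) := Real.rpow_nonneg (by positivity) _
    gcongr
  have hc : 0 ≤ 24 / 23 * 2 / Real.log M := by positivity
  have h5 : ∑ p ∈ primesUpTo M, wt p ≤ 7.3 * frt √M - 7 +
      24 / 23 * 2 / Real.log M * (4 * 1.3864 * frt M) := by
    have := mul_le_mul_of_nonneg_left hK hc
    linarith
  refine h5.trans ?_
  have key : (7.3 * frt √M - 7) * Real.log M ≤ 17.7 * frt M := by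
    set u := frt √M
    have hu1 : 1 ≤ u := by
      have : u ^ 4 = √M := frt_pow (by positivity)
      by_contra hcon
      push Not at hcon
      have : u ^ 4 < 1 := pow_lt_one₀ hu.le hcon (by norm_num)
      linarith
    have hl5 : Real.log 5 ≤ 1.61 := by
      rw [Real.log_le_iff_le_exp (by norm_num)]
      have e1 : (2.7182818283 : ℝ) < Real.exp 1 := Real.exp_one_gt_d9
      have e2 : (0.61 : ℝ) + 1 + 0.61 ^ 2 / 2 ≤ Real.exp 0.61 := by
        have := Real.quadratic_le_exp_of_nonneg (x := 0.61) (by norm_num)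
        linarith
      rw [show (1.61 : ℝ) = 1 + 0.61 by norm_num, Real.exp_add]
      have : (2.7182 : ℝ) * 1.8396 ≤ Real.exp 1 * Real.exp 0.61 := by
        apply mul_le_mul <;> first | positivity | skip
        · linarith
        · have := Real.sum_le_exp_of_nonneg (x := 0.61) (by norm_num) 5
          norm_num [Finset.sum_range_succ, Nat.factorial] at this
          norm_num
          linarith
      linarith
    have hlu : Real.log u ≤ u / 5 + 0.61 := by
      have := Real.log_le_sub_one_of_pos (x := u / 5) (by positivity)
      rw [Real.log_div hu.ne' (by norm_num)] at this
      linarith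
    rw [hlogu, hu2]
    have : (7.3 * u - 7) * (8 * Real.log u) ≤ (7.3 * u - 7) * (8 * (u / 5 + 0.61)) := by
      apply mul_le_mul_of_nonneg_left <;> linarith
    nlinarith [sq_nonneg (u - 2)]
  have key2 : 7.3 * frt √M - 7 ≤ 17.7 * (frt M / Real.log M) := by
    rw [← mul_div_assoc, le_div_iff₀ hlM]; exact key
  have : 24 / 23 * 2 / Real.log M * (4 * 1.3864 * frt M) =
      (24 / 23 * 2 * 4 * 1.3864) * (frt M / Real.log M) := by ring
  rw [this]
  have : 0 < frt M / Real.log M := by positivity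
  nlinarith

lemma log_diff {a : ℝ} (ha : a < 1) {z w : ℂ} (hz : ‖z‖ ≤ a) (hw : ‖w‖ ≤ a) :
    ‖Complex.log (1 - z) - Complex.log (1 - w)‖ ≤ 1 / (1 - a) * ‖z - w‖ := by
  have hconv : Convex ℝ (Metric.closedBall (0 : ℂ) a) := convex_closedBall 0 a
  refine hconv.norm_image_sub_le_of_norm_hasDerivWithin_le (𝕜 := ℂ)
    (f := fun z => Complex.log (1 - z)) (f' := fun z => -1 / (1 - z)) ?_ ?_
    (by simpa using hw) (by simpa using hz)
  · intro x hx
    have hx' : ‖x‖ ≤ a := by simpa using hx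
    have hre : x.re ≤ ‖x‖ := Complex.re_le_norm x
    have : (1 - x) ∈ Complex.slitPlane := by
      left; simp; linarith
    exact (((hasDerivAt_id x).const_sub 1).clog this).hasDerivWithinAt
  · intro x hx
    have hx' : ‖x‖ ≤ a := by simpa using hx
    have h1 : 1 - a ≤ ‖1 - x‖ := by
      have := norm_sub_norm_le (1 : ℂ) x
      simp at this
      linarith
    rw [norm_div, norm_neg, norm_one]
    exact one_div_le_one_div_of_le (by linarith) h1

lemma exp_diff (x y : ℝ) :
    ‖Complex.exp (2 * Real.pi * Complex.I * x) - Complex.exp (2 * Real.pi * Complex.I * y)‖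
      ≤ 2 * Real.pi * nearIntDist (x - y) := by
  set k := round (x - y) with hk
  have e : Complex.exp (2 * Real.pi * Complex.I * x) =
      Complex.exp (2 * Real.pi * Complex.I * y) *
        Complex.exp (Complex.I * ((2 * Real.pi * (x - y - k) : ℝ) : ℂ)) := by
    rw [← Complex.exp_add, Complex.exp_eq_exp_iff_exists_int]
    refine ⟨k, ?_⟩
    push_cast
    ring
  have hn : ‖Complex.exp (2 * Real.pi * Complex.I * y)‖ = 1 := by
    rw [show (2 * Real.pi * Complex.I * y : ℂ) = ((2 * Real.pi * y : ℝ) : ℂ) * Complex.I by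
      push_cast; ring]
    exact Complex.norm_exp_ofReal_mul_I _
  rw [e, show ∀ a b : ℂ, a * b - a = a * (b - 1) by intros; ring, norm_mul, hn, one_mul]
  refine Real.norm_exp_I_mul_ofReal_sub_one_le.trans ?_
  rw [Real.norm_eq_abs, abs_mul, abs_of_pos (by positivity)]
  rfl

lemma term_bound {q : ℕ} (χ : DirichletCharacter ℂ q) (x y : ℝ) {M r : ℝ} (hr : r < 1 / 4)
    {s : ℂ} (hs : norm s ≤ r) {p : ℕ} (hp : p.Prime) (hpM : (p : ℝ) ≤ M) :
    ‖Complex.log (1 - χ (p : ZMod q) *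
            Complex.exp (2 * Real.pi * Complex.I * x) * (p : ℂ) ^ (-(s + 3 / 4))) -
      Complex.log (1 - χ (p : ZMod q) *
            Complex.exp (2 * Real.pi * Complex.I * y) * (p : ℂ) ^ (-(s + 3 / 4)))‖ ≤
      2 * Real.pi * M ^ r * wt p * nearIntDist (x - y) := by
  have hp0 : (0 : ℝ) < p := by exact_mod_cast hp.pos
  have hp1 : (1 : ℝ) < p := by exact_mod_cast hp.one_lt
  have hr0 : 0 ≤ r := (norm_nonneg s).trans hs
  have hre : |s.re| ≤ r := (Complex.abs_re_le_norm s).trans hs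
  have hre' := abs_le.1 hre
  have hnorm : ‖(p : ℂ) ^ (-(s + 3 / 4))‖ = (p : ℝ) ^ (-(s.re + 3 / 4)) := by
    rw [Complex.norm_natCast_cpow_of_pos hp.pos]
    congr 1
    simp
  have hn1 : ‖(p : ℂ) ^ (-(s + 3 / 4))‖ ≤ (p : ℝ) ^ (-(1 / 2 : ℝ)) := by
    rw [hnorm]
    exact Real.rpow_le_rpow_of_exponent_le hp1.le (by linarith)
  have hn2 : ‖(p : ℂ) ^ (-(s + 3 / 4))‖ ≤ M ^ r * (p : ℝ) ^ (-(3 / 4 : ℝ)) := by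
    rw [hnorm]
    calc (p : ℝ) ^ (-(s.re + 3 / 4)) ≤ (p : ℝ) ^ (r + -(3 / 4)) :=
          Real.rpow_le_rpow_of_exponent_le hp1.le (by linarith)
      _ = (p : ℝ) ^ r * (p : ℝ) ^ (-(3 / 4 : ℝ)) := Real.rpow_add hp0 _ _
      _ ≤ _ := by gcongr
  have hχ : ‖χ (p : ZMod q)‖ ≤ 1 := χ.norm_le_one _
  have hexp : ∀ y : ℝ, ‖Complex.exp (2 * Real.pi * Complex.I * y)‖ = 1 := by
    intro y
    rw [show (2 * Real.pi * Complex.I * y : ℂ) = ((2 * Real.pi * y : ℝ) : ℂ) * Complex.I by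
      push_cast; ring]
    exact Complex.norm_exp_ofReal_mul_I _
  have hz : ∀ y : ℝ, ‖χ (p : ZMod q) *
            Complex.exp (2 * Real.pi * Complex.I * y) * (p : ℂ) ^ (-(s + 3 / 4))‖ ≤
            (p : ℝ) ^ (-(1 / 2 : ℝ)) := by
    intro y
    rw [norm_mul, norm_mul, hexp, mul_one]
    calc _ ≤ 1 * ‖(p : ℂ) ^ (-(s + 3 / 4))‖ := by gcongr
      _ ≤ _ := by rw [one_mul]; exact hn1
  have ha : (p : ℝ) ^ (-(1 / 2 : ℝ)) < 1 := Real.rpow_lt_one_of_one_lt_of_neg hp1 (by norm_num)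
  refine (log_diff ha (hz x) (hz y)).trans ?_
  have hd : ‖χ (p : ZMod q) *
            Complex.exp (2 * Real.pi * Complex.I * x) * (p : ℂ) ^ (-(s + 3 / 4)) -
      χ (p : ZMod q) *
            Complex.exp (2 * Real.pi * Complex.I * y) * (p : ℂ) ^ (-(s + 3 / 4))‖ ≤
      1 * (2 * Real.pi * nearIntDist (x - y)) * (M ^ r * (p : ℝ) ^ (-(3 / 4 : ℝ))) := by
    rw [show ∀ a b c d : ℂ, a * b * c - a * d * c = a * (b - d) * c by intros; ring,
      norm_mul, norm_mul]
    have hδ : 0 ≤ nearIntDist (x - y) := abs_nonneg _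
    gcongr
    exact exp_diff x y
  have hw : 1 / (1 - (p : ℝ) ^ (-(1 / 2 : ℝ))) * (p : ℝ) ^ (-(3 / 4 : ℝ)) = wt p := by
    have hb := frt_pos hp0
    have h0 : 1 - (p : ℝ) ^ (-(1 / 2 : ℝ)) ≠ 0 := by linarith
    rw [rpow_12 hp0] at h0
    rw [rpow_12 hp0, rpow_34 hp0, wt]
    have h2 : frt (p : ℝ) ^ 2 - 1 ≠ 0 := by
      intro h
      apply h0
      rw [show frt (p : ℝ) ^ 2 = 1 by linarith]; norm_num
    field_simp
  calc _ ≤ 1 / (1 - (p : ℝ) ^ (-(1 / 2 : ℝ))) *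
        (1 * (2 * Real.pi * nearIntDist (x - y)) * (M ^ r * (p : ℝ) ^ (-(3 / 4 : ℝ)))) := by
        apply mul_le_mul_of_nonneg_left hd
        apply one_div_nonneg.2; linarith
    _ = _ := by rw [← hw]; ring

lemma le_sup_near (S : Finset ℕ) (f : ℕ → ℝ) (hf : ∀ n, 0 ≤ f n) (hf1 : ∀ n, f n ≤ 1)
    {p : ℕ} (hp : p ∈ S) : f p ≤ ⨆ n ∈ S, f n := by
  have hb : BddAbove (Set.range fun n => ⨆ (_ : n ∈ S), f n) := by
    refine ⟨1, ?_⟩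
    rintro _ ⟨n, rfl⟩
    exact Real.iSup_le (fun _ => hf1 n) zero_le_one
  refine le_trans ?_ (le_ciSup hb p)
  simp [hp]

/-- Perturbing the phases in a sum of logarithms of Euler-type factors over primes
`p ≤ M` changes the sum by at most `184 M^{1/4+r}/log M` times the maximal phase
perturbation. -/
theorem stmt_13 (q : ℕ) (hq : 0 < q) [NeZero q] (χ : DirichletCharacter ℂ q)
    (lam lam' : ℕ → ℝ) (M r : ℝ) (hM : 355991 < M) (hr : r < 1 / 4)
    (s : ℂ) (hs : norm s ≤ r) :
    norm
      ((∑ p ∈ primesUpTo M,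
          Complex.log (1 - χ (p : ZMod q) *
            Complex.exp (2 * Real.pi * Complex.I * (lam p)) * (p : ℂ) ^ (-(s + 3 / 4)))) -
        ∑ p ∈ primesUpTo M,
          Complex.log (1 - χ (p : ZMod q) *
            Complex.exp (2 * Real.pi * Complex.I * (lam' p)) * (p : ℂ) ^ (-(s + 3 / 4)))) ≤
      184 * (M ^ ((1 : ℝ) / 4 + r) / Real.log M) *
        ⨆ p ∈ primesUpTo M, nearIntDist (lam p - lam' p) := by
  have hM0 : 0 < M := by linarith
  have hlM : 0 < Real.log M := Real.log_pos (by linarith)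
  set D := ⨆ p ∈ primesUpTo M, nearIntDist (lam p - lam' p) with hD
  have hle : ∀ p ∈ primesUpTo M, nearIntDist (lam p - lam' p) ≤ D := fun p hp =>
    le_sup_near (primesUpTo M) (fun p => nearIntDist (lam p - lam' p))
      (fun _ => abs_nonneg _)
      (fun n => (abs_sub_round (lam n - lam' n)).trans (by norm_num)) hp
  have hD0 : 0 ≤ D := Real.iSup_nonneg fun p => Real.iSup_nonneg fun _ => abs_nonneg _
  rw [← Finset.sum_sub_distrib]
  have hMr : 0 < M ^ r := Real.rpow_pos_of_pos hM0 r
  have hfM : 0 < frt M := frt_pos hM0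
  calc _ ≤ ∑ p ∈ primesUpTo M, 2 * Real.pi * M ^ r * D * wt p := by
        refine (norm_sum_le _ _).trans (Finset.sum_le_sum fun p hp => ?_)
        have hp' := hp
        simp only [primesUpTo, Finset.mem_filter, Finset.mem_range] at hp'
        have hpM : (p : ℝ) ≤ M :=
          (Nat.le_floor_iff hM0.le).1 (Nat.lt_succ_iff.1 hp'.1)
        refine (term_bound χ _ _ hr hs hp'.2 hpM).trans ?_
        have h1 := hle p hp
        have h2 := wt_nonneg hp'.2.one_lt.le
        have : 0 ≤ 2 * Real.pi * M ^ r * wt p := by positivity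
        nlinarith [mul_le_mul_of_nonneg_left h1 this]
    _ = 2 * Real.pi * M ^ r * D * ∑ p ∈ primesUpTo M, wt p := by rw [Finset.mul_sum]
    _ ≤ 2 * 3.1416 * M ^ r * D * (29.28 * (frt M / Real.log M)) := by
        have := sum_wt hM
        have hpi : Real.pi ≤ 3.1416 := Real.pi_lt_d4.le
        have h0 : 0 ≤ ∑ p ∈ primesUpTo M, wt p := Finset.sum_nonneg fun p hp =>
          wt_nonneg (Finset.mem_filter.1 hp).2.one_lt.le
        gcongr
    _ = (2 * 3.1416 * 29.28) * (M ^ r * D * (frt M / Real.log M)) := by ring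
    _ ≤ 184 * (M ^ r * D * (frt M / Real.log M)) := by
        gcongr
        norm_num
    _ = _ := by
        rw [Real.rpow_add hM0, frt]; ring
end

section
/- Let K be a compact subset of the strip 1/2 < Re s < 1 with connected complement, and let g be continuous on K and analytic in the interior of K. Let α ∈ (0, 1) be an algebraic irrational number and let {α_n} ⊂ (0, 1] ∩ ℚ be a sequence of rational numbers converging to α. Suppose that for every sufficiently small ε > 0 there is c(ε) > 0 such that liminf_{T→∞} limsup_{n→∞} (1/T) meas{ τ ∈ [T, 2T] : sup_{s ∈ K} |ζ(s + iτ, α_n) − g(s)| < ε } ≥ c(ε). Then for every such ε > 0, liminf_{T→∞} (1/T) meas{ τ ∈ [T, 2T] : sup_{s ∈ K} |ζ(s + iτ, α) − g(s)| < ε } > 0. -/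
open MeasureTheory

lemma hz_term (δ : ℝ) (hδ0 : 0 < δ) (hδ1 : δ ≤ 1) (x y : ℝ) (hx : δ ≤ x) (hy : δ ≤ y)
    (M : ℝ) (z : ℂ) (h1 : 1 / 2 < z.re) (h2 : z.re < 2) (hM : ‖z‖ ≤ M) (n : ℕ) :
    ‖1 / ((n : ℂ) + x) ^ z - 1 / ((n : ℂ) + y) ^ z‖
      ≤ (M * δ ^ (-3 : ℝ) * |x - y|) * (1 / ((n : ℝ) + 1) ^ (3 / 2 : ℝ)) := by
  have hn : (0 : ℝ) ≤ n := Nat.cast_nonneg n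
  have hM0 : 0 ≤ M := (norm_nonneg _).trans hM
  have hz : z ≠ 0 := by
    rintro rfl
    simp at h1
    linarith
  have key := Convex.norm_image_sub_le_of_norm_hasDerivWithin_le
    (f := fun t : ℝ => (t : ℂ) ^ (-z)) (f' := fun t : ℝ => (-z) * (t : ℂ) ^ (-z - 1))
    (s := Set.Ici ((n : ℝ) + δ)) (C := M * δ ^ (-3 : ℝ) * (1 / ((n : ℝ) + 1) ^ (3 / 2 : ℝ)))
    (x := (n : ℝ) + y) (y := (n : ℝ) + x) ?_ ?_ (convex_Ici _) ?_ ?_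
  · have e : ((n : ℝ) + x) - ((n : ℝ) + y) = x - y := by ring
    rw [e, Real.norm_eq_abs] at key
    simp only [Complex.ofReal_add, Complex.ofReal_natCast, Complex.cpow_neg] at key
    simp only [one_div] at key ⊢
    calc _ ≤ _ := key
      _ = _ := by ring
  · intro t ht
    have ht' : (n : ℝ) + δ ≤ t := ht
    have ht0 : 0 < t := by linarith
    have h3 : HasDerivAt (fun w : ℂ => w ^ (-z)) ((-z) * (t : ℂ) ^ (-z - 1)) (t : ℂ) := by
      have := (hasDerivAt_id (t : ℂ)).cpow_const (c := -z) (Or.inl (by simpa using ht0))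
      simpa using this
    exact h3.comp_ofReal.hasDerivWithinAt
  · intro t ht
    have ht' : (n : ℝ) + δ ≤ t := ht
    have ht0 : 0 < t := by linarith
    rw [norm_mul, norm_neg, Complex.norm_cpow_eq_rpow_re_of_pos ht0, mul_assoc]
    refine mul_le_mul hM ?_ (by positivity) hM0
    have hlow : δ * ((n : ℝ) + 1) ≤ t := by nlinarith
    have e : (-z - 1).re = -(z.re + 1) := by simp; ring
    rw [e]
    calc t ^ (-(z.re + 1)) ≤ (δ * ((n : ℝ) + 1)) ^ (-(z.re + 1)) :=
          Real.rpow_le_rpow_of_nonpos (by positivity) hlow (by linarith)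
      _ = δ ^ (-(z.re + 1)) * ((n : ℝ) + 1) ^ (-(z.re + 1)) :=
          Real.mul_rpow hδ0.le (by positivity)
      _ ≤ δ ^ (-3 : ℝ) * ((n : ℝ) + 1) ^ (-(3 / 2) : ℝ) := by
          apply mul_le_mul _ _ (by positivity) (by positivity)
          · exact Real.rpow_le_rpow_of_exponent_ge hδ0 hδ1 (by linarith)
          · exact Real.rpow_le_rpow_of_exponent_le (by linarith) (by linarith)
      _ = _ := by rw [Real.rpow_neg (by positivity : (0 : ℝ) ≤ (n : ℝ) + 1), one_div]
  · simpa using hy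
  · simpa using hx

lemma hz_summable : Summable (fun n : ℕ => 1 / ((n : ℝ) + 1) ^ (3 / 2 : ℝ)) := by
  have := (summable_nat_add_iff 1).2
    (Real.summable_one_div_nat_rpow (p := (3 / 2 : ℝ)).2 (by norm_num))
  simpa using this

lemma hz_bound (δ : ℝ) (hδ0 : 0 < δ) (hδ1 : δ ≤ 1) (x y : ℝ) (hx : δ ≤ x) (hy : δ ≤ y)
    (hx1 : x ≤ 1) (hy1 : y ≤ 1)
    (M : ℝ) (s : ℂ) (h1 : 1 / 2 < s.re) (h2 : s.re < 2) (hM : ‖s‖ < M) (hM2 : 2 < M) :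
    ‖HurwitzZeta.hurwitzZeta (x : UnitAddCircle) s - HurwitzZeta.hurwitzZeta (y : UnitAddCircle) s‖
      ≤ (M * δ ^ (-3 : ℝ) * |x - y|) * ∑' n : ℕ, (1 / ((n : ℝ) + 1) ^ (3 / 2 : ℝ)) := by
  set U : Set ℂ := ({z : ℂ | 1 / 2 < z.re} ∩ {z : ℂ | z.re < 2}) ∩ Metric.ball 0 M with hU
  have hUo : IsOpen U :=
    ((isOpen_lt continuous_const Complex.continuous_re).inter
      (isOpen_lt Complex.continuous_re continuous_const)).inter Metric.isOpen_ball
  have hUc : Convex ℝ U :=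
    ((convex_halfSpace_re_gt _).inter (convex_halfSpace_re_lt _)).inter (convex_ball _ _)
  have hmem : ∀ z, z ∈ U ↔ (1 / 2 < z.re ∧ z.re < 2) ∧ ‖z‖ < M := by
    intro z; simp [hU]
  set F : ℕ → ℂ → ℂ := fun n z => 1 / ((n : ℂ) + x) ^ z - 1 / ((n : ℂ) + y) ^ z with hF
  set u : ℕ → ℝ := fun n => (M * δ ^ (-3 : ℝ) * |x - y|) * (1 / ((n : ℝ) + 1) ^ (3 / 2 : ℝ))
    with hu
  have hus : Summable u := hz_summable.mul_left _
  have hbd : ∀ n z, z ∈ U → ‖F n z‖ ≤ u n := by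
    intro n z hz
    obtain ⟨⟨ha, hb⟩, hc⟩ := (hmem z).1 hz
    exact hz_term δ hδ0 hδ1 x y hx hy M z ha hb hc.le n
  have hne : ∀ (n : ℕ) (w : ℝ), δ ≤ w → ((n : ℂ) + w) ≠ 0 := by
    intro n w hw h0
    have h3 : (n : ℝ) + w = 0 := by exact_mod_cast h0
    have hn : (0 : ℝ) ≤ n := Nat.cast_nonneg n
    linarith
  have hd : ∀ n, Differentiable ℂ (F n) := by
    intro n z
    have aux : ∀ w : ℝ, δ ≤ w → DifferentiableAt ℂ (fun z : ℂ => 1 / ((n : ℂ) + w) ^ z) z := by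
      intro w hw
      refine DifferentiableAt.div (by fun_prop) ?_ ?_
      · exact differentiableAt_id.const_cpow (Or.inl (hne n w hw))
      · simp [Complex.cpow_eq_zero_iff, hne n w hw]
    exact (aux x hx).sub (aux y hy)
  have hdt : DifferentiableOn ℂ (fun z => ∑' n, F n z) U :=
    Complex.differentiableOn_tsum_of_summable_norm hus (fun n => (hd n).differentiableOn) hUo hbd
  have hdz := HurwitzZeta.differentiable_hurwitzZeta_sub_hurwitzZeta
    (x : UnitAddCircle) (y : UnitAddCircle)
  have hEq : Set.EqOn (fun z => HurwitzZeta.hurwitzZeta (x : UnitAddCircle) z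
      - HurwitzZeta.hurwitzZeta (y : UnitAddCircle) z) (fun z => ∑' n, F n z) U := by
    refine (hdz.differentiableOn.analyticOnNhd hUo).eqOn_of_preconnected_of_eventuallyEq
      (hdt.analyticOnNhd hUo) hUc.isPreconnected (z₀ := ((3 / 2 : ℝ) : ℂ)) ?_ ?_
    · rw [hmem, Complex.ofReal_re, Complex.norm_real, Real.norm_eq_abs, abs_of_pos (by norm_num)]
      refine ⟨⟨by norm_num, by norm_num⟩, by linarith⟩
    · have : {z : ℂ | 1 < z.re} ∈ nhds ((3 / 2 : ℝ) : ℂ) := by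
        apply (isOpen_lt continuous_const Complex.continuous_re).mem_nhds
        simp only [Set.mem_ofPred_eq, Complex.ofReal_re]
        norm_num
      filter_upwards [this] with z hz
      have hx' := HurwitzZeta.hasSum_hurwitzZeta_of_one_lt_re (a := x) ⟨by linarith, hx1⟩ hz
      have hy' := HurwitzZeta.hasSum_hurwitzZeta_of_one_lt_re (a := y) ⟨by linarith, hy1⟩ hz
      exact (hx'.sub hy').tsum_eq.symm
  have hsU : s ∈ U := (hmem s).2 ⟨⟨h1, h2⟩, hM⟩
  have h5 := hEq hsU
  simp only at h5
  rw [h5, ← tsum_mul_left]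
  exact tsum_of_norm_bounded hus.hasSum (fun n => hbd n s hsU)

/-- If a uniform positive lower density bound for approximation by Hurwitz zeta
functions holds along a sequence of rational parameters converging to an algebraic
irrational `α`, then the universality lower density for `ζ(s, α)` is positive. -/
theorem stmt_18 (K : Set ℂ) (hK : IsCompact K)
    (hKs : K ⊆ {s : ℂ | 1 / 2 < s.re ∧ s.re < 1}) (hKc : IsConnected Kᶜ)
    (g : ℂ → ℂ) (hg : ContinuousOn g K) (hg' : AnalyticOnNhd ℂ g (interior K))
    (α : ℝ) (hα0 : 0 < α) (hα1 : α < 1) (halg : IsAlgebraic ℚ α) (hirr : Irrational α)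
    (a : ℕ → ℚ) (ha : ∀ n, 0 < a n ∧ a n ≤ 1)
    (hconv : Filter.Tendsto (fun n => (a n : ℝ)) Filter.atTop (nhds α))
    (ε₀ : ℝ) (hε₀ : 0 < ε₀)
    (h : ∀ ε : ℝ, 0 < ε → ε < ε₀ → ∃ c : ℝ, 0 < c ∧
      Filter.liminf (fun T : ℝ =>
        Filter.limsup (fun n : ℕ =>
          (volume {τ : ℝ | τ ∈ Set.Icc T (2 * T) ∧ ∀ s ∈ K,
            norm (HurwitzZeta.hurwitzZeta ((a n : ℝ) : UnitAddCircle)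
              (s + τ * Complex.I) - g s) < ε}).toReal / T) Filter.atTop)
        Filter.atTop ≥ c) :
    ∀ ε : ℝ, 0 < ε → ε < ε₀ →
      Filter.liminf (fun T : ℝ =>
        (volume {τ : ℝ | τ ∈ Set.Icc T (2 * T) ∧ ∀ s ∈ K,
          norm (HurwitzZeta.hurwitzZeta (α : UnitAddCircle)
            (s + τ * Complex.I) - g s) < ε}).toReal / T) Filter.atTop > 0 := by
  intro ε hε hε1
  obtain ⟨c, hc, hcl⟩ := h (ε / 2) (by linarith) (by linarith)
  refine lt_of_lt_of_le hc (le_trans hcl ?_)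
  -- bounds on normalized measures
  have hb : ∀ (P : ℝ → Prop) (T : ℝ), 0 < T →
      (volume {τ : ℝ | τ ∈ Set.Icc T (2 * T) ∧ P τ}).toReal / T ≤ 1 := by
    intro P T hT
    rw [div_le_one hT]
    have h1 : volume {τ : ℝ | τ ∈ Set.Icc T (2 * T) ∧ P τ} ≤ volume (Set.Icc T (2 * T)) :=
      measure_mono fun τ hτ => hτ.1
    rw [Real.volume_Icc] at h1
    have h2 := ENNReal.toReal_mono ENNReal.ofReal_ne_top h1
    rw [ENNReal.toReal_ofReal (by linarith)] at h2
    linarith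
  have hnn : ∀ (P : ℝ → Prop) (T : ℝ), 0 < T →
      0 ≤ (volume {τ : ℝ | τ ∈ Set.Icc T (2 * T) ∧ P τ}).toReal / T := by
    intro P T hT
    positivity
  have hT0 : ∀ᶠ T : ℝ in Filter.atTop, 0 < T := Filter.eventually_gt_atTop 0
  refine Filter.liminf_le_liminf ?_ ?_ ?_
  · filter_upwards [hT0] with T hT
    refine Filter.limsup_le_of_le ?_ ?_
    · exact Filter.IsCoboundedUnder.of_frequently_ge (a := 0)
        (Filter.Frequently.of_forall fun n => hnn _ T hT)
    · obtain ⟨R, hR⟩ := hK.isBounded.exists_norm_le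
      have hδ0 : 0 < α / 2 := by linarith
      set M : ℝ := |R| + 2 * T + 3 with hM
      have hRnn := abs_nonneg R
      set B : ℝ := ∑' n : ℕ, (1 / ((n : ℝ) + 1) ^ (3 / 2 : ℝ)) with hB
      have hlim : Filter.Tendsto (fun n => (M * (α / 2) ^ (-3 : ℝ) * |(a n : ℝ) - α|) * B)
          Filter.atTop (nhds 0) := by
        have h1 : Filter.Tendsto (fun n => |(a n : ℝ) - α|) Filter.atTop (nhds 0) := by
          have := (hconv.sub_const α).abs
          simpa using this
        have := (h1.const_mul (M * (α / 2) ^ (-3 : ℝ))).mul_const B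
        simpa using this
      filter_upwards [hlim.eventually_lt_const (show (0 : ℝ) < ε / 2 by linarith),
        hconv.eventually_const_le (show α / 2 < α by linarith)] with n hn1 hn2
      have hsub : {τ : ℝ | τ ∈ Set.Icc T (2 * T) ∧ ∀ s ∈ K,
            norm (HurwitzZeta.hurwitzZeta ((a n : ℝ) : UnitAddCircle)
              (s + τ * Complex.I) - g s) < ε / 2} ⊆ {τ : ℝ | τ ∈ Set.Icc T (2 * T) ∧ ∀ s ∈ K,
          norm (HurwitzZeta.hurwitzZeta (α : UnitAddCircle)
            (s + τ * Complex.I) - g s) < ε} := by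
        rintro τ ⟨hτ, hs⟩
        refine ⟨hτ, fun s hsK => ?_⟩
        have hre : (s + τ * Complex.I).re = s.re := by simp
        have hsr := hKs hsK
        have hnorm : ‖s + τ * Complex.I‖ < M := by
          have h1 := norm_add_le s (τ * Complex.I)
          have h2 : ‖(τ : ℂ) * Complex.I‖ = |τ| := by simp
          have h3 := hR s hsK
          have h4 : |τ| = τ := abs_of_pos (by linarith [hτ.1])
          have h5 := le_abs_self R
          have h6 := hτ.2
          rw [hM]
          linarith
        have hz := hz_bound (α / 2) hδ0 (by linarith) (a n : ℝ) α hn2 (by linarith)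
          (by exact_mod_cast (ha n).2) hα1.le M (s + τ * Complex.I) (by rw [hre]; exact hsr.1)
          (by rw [hre]; linarith [hsr.2]) hnorm (by rw [hM]; linarith)
        have hs' := hs s hsK
        rw [norm_sub_rev] at hz
        have htri := norm_sub_le_norm_sub_add_norm_sub
          (HurwitzZeta.hurwitzZeta (α : UnitAddCircle) (s + τ * Complex.I))
          (HurwitzZeta.hurwitzZeta ((a n : ℝ) : UnitAddCircle) (s + τ * Complex.I)) (g s)
        linarith
      refine div_le_div_of_nonneg_right (ENNReal.toReal_mono ?_ (measure_mono hsub)) hT.le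
      exact measure_ne_top_of_subset (fun τ hτ => hτ.1)
        (by rw [Real.volume_Icc]; exact ENNReal.ofReal_ne_top)
  · refine Filter.isBoundedUnder_of_eventually_ge (a := 0) ?_
    filter_upwards [hT0] with T hT
    refine Filter.le_limsup_of_frequently_le
      (Filter.Frequently.of_forall fun n => hnn _ T hT) ?_
    exact Filter.isBoundedUnder_of_eventually_le (a := 1)
      (Filter.Eventually.of_forall fun n => hb _ T hT)
  · refine Filter.IsCoboundedUnder.of_frequently_le (a := 1) ?_
    refine Filter.Eventually.frequently ?_
    filter_upwards [hT0] with T hT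
    exact hb _ T hT
end

section
/- Let K and L be positive integers with K ≤ L, and let a_{kl} and b_k, for 1 ≤ k ≤ K and 1 ≤ l ≤ L, be complex numbers. Suppose the system of equations ∑_{l=1}^{L} a_{kl} z_l = b_k (1 ≤ k ≤ K) has a solution (z_1,…,z_L) in the polydisc Δ^L = {(z_1,…,z_L) : z_l ∈ ℂ, |z_l| ≤ 1 for 1 ≤ l ≤ L}. Then the system has a solution (z'_1,…,z'_L) ∈ Δ^L such that |z'_l| = 1 for at least L − K of the indices l ≤ L. -/
/-- Lemma of Good: a solvable linear system with solution in the closed unit polydisc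
has a solution with all but at most `K` coordinates of modulus one. -/
theorem stmt_19 (K L : ℕ) (hK : 0 < K) (hL : 0 < L) (hKL : K ≤ L)
    (a : Fin K → Fin L → ℂ) (b : Fin K → ℂ)
    (h : ∃ z : Fin L → ℂ, (∀ l, ‖z l‖ ≤ 1) ∧
      ∀ k, ∑ l, a k l * z l = b k) :
    ∃ z' : Fin L → ℂ, (∀ l, ‖z' l‖ ≤ 1) ∧
      (∀ k, ∑ l, a k l * z' l = b k) ∧
      L - K ≤ (Finset.univ.filter fun l : Fin L => ‖z' l‖ = 1).card := by
  -- maximise the sum of squares over the compact set of solutions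
  let C : Set (Fin L → ℂ) := {z | (∀ l, ‖z l‖ ≤ 1) ∧ ∀ k, ∑ l, a k l * z l = b k}
  have hcl : IsClosed C := by
    have e : C = (⋂ l, {z | ‖z l‖ ≤ 1}) ∩ ⋂ k, {z | ∑ l, a k l * z l = b k} := by
      ext z; simp [C]
    rw [e]
    refine IsClosed.inter (isClosed_iInter fun l => ?_) (isClosed_iInter fun k => ?_)
    · exact isClosed_le (by fun_prop) (by fun_prop)
    · exact isClosed_eq (by fun_prop) (by fun_prop)
  have hcomp : IsCompact C := by
    refine (isCompact_closedBall (0 : Fin L → ℂ) 1).of_isClosed_subset hcl fun z hz => ?_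
    rw [mem_closedBall_zero_iff, pi_norm_le_iff_of_nonneg zero_le_one]
    exact hz.1
  obtain ⟨z, hz, hmax⟩ := hcomp.exists_isMaxOn (f := fun z : Fin L → ℂ => ∑ l, ‖z l‖ ^ 2) h
    (by fun_prop)
  refine ⟨z, hz.1, hz.2, ?_⟩
  by_contra hlt
  push Not at hlt
  let T : (Fin L → ℂ) →ₗ[ℂ] (Fin K → ℂ) × ({l : Fin L // ‖z l‖ = 1} → ℂ) :=
    LinearMap.prod (Matrix.mulVecLin (Matrix.of a)) (LinearMap.funLeft ℂ ℂ Subtype.val)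
  have hker : LinearMap.ker T ≠ ⊥ := by
    apply LinearMap.ker_ne_bot_of_finrank_lt
    rw [Module.finrank_prod, Module.finrank_fin_fun, Module.finrank_fin_fun,
      Module.finrank_fintype_fun_eq_card, Fintype.card_subtype]
    omega
  obtain ⟨w, hw, hw0⟩ := Submodule.exists_mem_ne_zero_of_ne_bot hker
  have hT : T w = 0 := hw
  have hw1 : ∀ k, ∑ l, a k l * w l = 0 := fun k => congrFun (congrArg Prod.fst hT) k
  have hw2 : ∀ l, ‖z l‖ = 1 → w l = 0 := fun l hl => congrFun (congrArg Prod.snd hT) ⟨l, hl⟩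
  have hev : ∀ᶠ t : ℝ in nhdsWithin 0 (Set.Ioi 0), ∀ l, ‖z l‖ + t * ‖w l‖ ≤ 1 := by
    rw [Filter.eventually_all]
    intro l
    by_cases hl : ‖z l‖ = 1
    · simp [hw2 l hl, hl]
    · have hl' : ‖z l‖ < 1 := lt_of_le_of_ne (hz.1 l) hl
      have hc : Continuous fun t : ℝ => ‖z l‖ + t * ‖w l‖ := by fun_prop
      have := (hc.tendsto 0).eventually_lt_const (u := 1) (by simpa using hl')
      exact (this.filter_mono nhdsWithin_le_nhds).mono fun _ h => h.le
  obtain ⟨t, ht, htpos⟩ := (hev.and self_mem_nhdsWithin).exists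
  have htpos : 0 < t := htpos
  have hn : ∀ l, ‖(t : ℂ) * w l‖ = t * ‖w l‖ := fun l => by
    rw [norm_mul, Complex.norm_real, Real.norm_of_nonneg htpos.le]
  have hp : (fun l => z l + t * w l) ∈ C := by
    refine ⟨fun l => (norm_add_le _ _).trans (by rw [hn]; exact ht l), fun k => ?_⟩
    simp only [mul_add, Finset.sum_add_distrib, mul_left_comm _ (t : ℂ), ← Finset.mul_sum, hw1, hz.2]
    simp
  have hm : (fun l => z l - t * w l) ∈ C := by
    refine ⟨fun l => (norm_sub_le _ _).trans (by rw [hn]; exact ht l), fun k => ?_⟩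
    simp only [mul_sub, Finset.sum_sub_distrib, mul_left_comm _ (t : ℂ), ← Finset.mul_sum, hw1, hz.2]
    simp
  have h1 : ∑ l, ‖z l + t * w l‖ ^ 2 ≤ ∑ l, ‖z l‖ ^ 2 := hmax hp
  have h2 : ∑ l, ‖z l - t * w l‖ ^ 2 ≤ ∑ l, ‖z l‖ ^ 2 := hmax hm
  have h3 : ∑ l, ‖z l + t * w l‖ ^ 2 + ∑ l, ‖z l - t * w l‖ ^ 2
      = 2 * ∑ l, ‖z l‖ ^ 2 + 2 * ∑ l, (t * ‖w l‖) ^ 2 := by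
    rw [← Finset.sum_add_distrib, Finset.mul_sum, Finset.mul_sum, ← Finset.sum_add_distrib]
    refine Finset.sum_congr rfl fun l _ => ?_
    have := parallelogram_law_with_norm ℂ (z l) (t * w l)
    rw [hn] at this
    linarith
  have h4 : 0 < ∑ l, (t * ‖w l‖) ^ 2 := by
    obtain ⟨l, hl⟩ := Function.ne_iff.mp hw0
    refine Finset.sum_pos' (fun _ _ => by positivity) ⟨l, Finset.mem_univ l, ?_⟩
    have : 0 < ‖w l‖ := norm_pos_iff.mpr hl
    positivity
  linarith
end
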